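/- arXiv:2605.16729 — 3 statements merged into one kernel-verified Lean document; each statement's English description precedes it below -/
import Mathlib

section
/- Let q_1 be a power of p and suppose q = q_1^{2ν} for some integer ν ≥ 1. Assume F satisfies conditions (i)–(iv) and that W_F* is contained in F_{q_1}. Set R := R_F, n := [F_q:F_2], and for a ∈ F_q let N(a) := |{(x,y) ∈ F_q × F_q : y^p − y = x(R(x) + a x)}|, T_{R,max} := {a : N(a) = q + (p−1)p^e·2^{n/2}}, T_{R,min} := {a : N(a) = q − (p−1)p^e·2^{n/2}}, and S_F := {t ∈ F_q : Q_q(v) = ψ_q(tv) for all v ∈ W_F*}. Then: (1) there exists t_0 ∈ F_{q_1²} ⊆ F_q with t_0^{q_1} + t_0 = 1; (2) for any such t_0, S_F = {t_0 + F(u) : u ∈ F_q} and T_{R,max} ∪ T_{R,min} = {α_F(t_0) + (F*(F(u)))² : u ∈ F_q}; (3) for any such t_0, T_{R,max} = {α_F(t_0) + (F*(F(u)))² : u ∈ F_q with Tr_{F_q/F_2}(u·R_{F,t_0}(u)) = image of (ν + 1) in F_2}. -/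
open Finset

open scoped Classical

noncomputable section

/-- Length-two Witt vectors, with the operations specialised to characteristic two. -/
def W2 (R : Type*) := R × R

namespace W2

variable {R : Type*} [CommRing R]

instance : Zero (W2 R) := ⟨((0, 0) : R × R)⟩

instance : Add (W2 R) := ⟨fun x y => ((x.1 + y.1, x.2 + y.2 + x.1 * y.1) : R × R)⟩

instance [CharP R 2] : Neg (W2 R) := ⟨fun x => ((x.1, x.2 + x.1 * x.1) : R × R)⟩

theorem fst_add (x y : W2 R) : (x + y).1 = x.1 + y.1 := rfl
theorem snd_add (x y : W2 R) : (x + y).2 = x.2 + y.2 + x.1 * y.1 := rfl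
theorem fst_zero : (0 : W2 R).1 = 0 := rfl
theorem snd_zero : (0 : W2 R).2 = 0 := rfl
theorem fst_neg [CharP R 2] (x : W2 R) : (-x).1 = x.1 := rfl
theorem snd_neg [CharP R 2] (x : W2 R) : (-x).2 = x.2 + x.1 * x.1 := rfl

instance [CharP R 2] : AddCommGroup (W2 R) where
  add := (· + ·)
  zero := 0
  neg := Neg.neg
  add_assoc a b c := Prod.ext_iff.mpr (by
    constructor <;> simp only [fst_add, snd_add] <;> ring)
  zero_add a := Prod.ext_iff.mpr (by
    constructor <;> simp [fst_add, snd_add, fst_zero, snd_zero])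
  add_zero a := Prod.ext_iff.mpr (by
    constructor <;> simp [fst_add, snd_add, fst_zero, snd_zero])
  add_comm a b := Prod.ext_iff.mpr (by
    constructor <;> simp only [fst_add, snd_add] <;> ring)
  neg_add_cancel a := Prod.ext_iff.mpr (by
    constructor
    · simp only [fst_add, fst_neg, fst_zero]
      exact CharTwo.add_self_eq_zero a.1
    · simp only [snd_add, snd_neg, snd_zero, fst_neg]
      rw [show a.2 + a.1 * a.1 + a.2 + a.1 * a.1
            = (a.2 + a.2) + (a.1 * a.1 + a.1 * a.1) by ring]
      rw [CharTwo.add_self_eq_zero, CharTwo.add_self_eq_zero, add_zero])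
  nsmul := nsmulRec
  zsmul := zsmulRec

/-- Frobenius on length-two Witt vectors (characteristic two). -/
def frob (x : W2 R) : W2 R := ((x.1 ^ 2, x.2 ^ 2) : R × R)

/-- The Witt-vector trace `Tr_{q/2} = ∑_{i=0}^{n-1} Frobⁱ`. -/
def tr [CharP R 2] (n : ℕ) (x : W2 R) : W2 R := ∑ i ∈ Finset.range n, frob^[i] x

/-- The additive character of `W₂(𝔽₂)` determined by `ξ₂(1,0) = I`
(for `I` a fixed primitive fourth root of unity), evaluated on Witt vectors
whose components lie in the prime field `𝔽₂ = {0,1}`. -/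
def xi (I : ℂ) (x : W2 R) : ℂ := (if x.1 = 0 then 1 else I) * (if x.2 = 0 then 1 else -1)

end W2

variable {K : Type*}

/-- The absolute trace `Tr_{q/2} : 𝔽_q → 𝔽₂`, computed inside `K` (here `q = 2^n`). -/
def tr2 [Field K] (n : ℕ) (x : K) : K := ∑ i ∈ Finset.range n, x ^ 2 ^ i

/-- The relative trace `Tr_{q/p} : 𝔽_q → 𝔽_p ⊆ 𝔽_q`, computed inside `K`
(here `q = p^m`). -/
def trp [Field K] (p m : ℕ) (x : K) : K := ∑ i ∈ Finset.range m, x ^ p ^ i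

/-- The character `ψ_q(x) = (-1)^{Tr_{q/2}(x)}`. -/
def psiq [Field K] (n : ℕ) (x : K) : ℂ := if tr2 n x = 0 then 1 else -1

/-- The map `Q_q(x) = ξ₂(Tr_{q/2}(x,0))` on Witt vectors of length two. -/
def Qq [Field K] [CharP K 2] (I : ℂ) (n : ℕ) (x : K) : ℂ :=
  W2.xi I (W2.tr n (((x, 0) : K × K) : W2 K))

/-- The unique `2^j`-th root in a perfect field of characteristic two. -/
def rt (L : Type*) [Field L] [ExpChar L 2] [PerfectRing L 2] (j : ℕ) (x : L) : L :=
  (fun y => (frobeniusEquiv L 2).symm y)^[j] x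

/-- Evaluation of the `𝔽_p`-linearised polynomial `∑_{i=0}^{e} c_i x^{p^i}`. -/
def Lpoly [Field K] (p e : ℕ) (c : ℕ → K) (x : K) : K :=
  ∑ i ∈ Finset.range (e + 1), c i * x ^ p ^ i

/-- The adjoint `f^*(x) = ∑_{i=0}^{e} (c_i x)^{p^{-i}}` (with `p = 2^k`). -/
def adj [Field K] [ExpChar K 2] [PerfectRing K 2] (k e : ℕ) (c : ℕ → K) (x : K) : K :=
  ∑ i ∈ Finset.range (e + 1), rt K (k * i) (c i * x)

/-- Evaluation of the `𝔽_p`-linearised polynomial `∑_{i=1}^{e} c_i x^{p^i}`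
(no constant-in-`x` coefficient). -/
def LpolyIcc [Field K] (p e : ℕ) (c : ℕ → K) (x : K) : K :=
  ∑ i ∈ Finset.Icc 1 e, c i * x ^ p ^ i

/-- The adjoint `R^*(x) = ∑_{i=1}^{e} (c_i x)^{p^{-i}}` (with `p = 2^k`). -/
def adjIcc [Field K] [ExpChar K 2] [PerfectRing K 2] (k e : ℕ) (c : ℕ → K) (x : K) : K :=
  ∑ i ∈ Finset.Icc 1 e, rt K (k * i) (c i * x)

/-- The coefficients `a_i = ∑_{j=0}^{e-i} (b_j b_{j+i})^{p^{-j}}` of `R_F` (with `p = 2^k`). -/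
def aRF [Field K] [ExpChar K 2] [PerfectRing K 2] (k e : ℕ) (b : ℕ → K) (i : ℕ) : K :=
  ∑ j ∈ Finset.range (e - i + 1), rt K (k * j) (b j * b (j + i))

/-- The linearised polynomial `R_F(x) = ∑_{i=1}^{e} a_i x^{p^i}` (with `p = 2^k`). -/
def RF [Field K] [ExpChar K 2] [PerfectRing K 2] (k e : ℕ) (b : ℕ → K) (x : K) : K :=
  ∑ i ∈ Finset.Icc 1 e, aRF k e b i * x ^ (2 ^ k) ^ i

/-- `γ_F = ∑_{0 ≤ i < j ≤ e} b_i^{p^{-i}} b_j^{p^{-j}}` (with `p = 2^k`). -/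
def gammaF [Field K] [ExpChar K 2] [PerfectRing K 2] (k e : ℕ) (b : ℕ → K) : K :=
  ∑ i ∈ Finset.range (e + 1), ∑ j ∈ Finset.Ioo i (e + 1), rt K (k * i) (b i) * rt K (k * j) (b j)

/-- `α_F(t) = γ_F + F^*(t)²`. -/
def alphaF [Field K] [ExpChar K 2] [PerfectRing K 2] (k e : ℕ) (b : ℕ → K) (t : K) : K :=
  gammaF k e b + adj k e b t ^ 2

/-- `R_{F,t}(x) = R_F(x) + α_F(t) x`. -/
def RFt [Field K] [ExpChar K 2] [PerfectRing K 2] (k e : ℕ) (b : ℕ → K) (t x : K) : K :=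
  RF k e b x + alphaF k e b t * x

/-- The number of affine points of the van der Geer–van der Vlugt curve
`y^p - y = x R(x)` with coordinates in `K`. -/
def Ncount (K : Type*) [Field K] (p : ℕ) (R : K → K) : ℕ :=
  Nat.card {z : K × K // z.2 ^ p - z.2 = z.1 * R z.1}

/-- The adjoint `F^*` of `F(x) = ∑_{i=0}^{e} b_i x^{p^i}`, with coefficients `b_i ∈ K`,
viewed as a function on the algebraic closure `𝔽` of `K`. -/
def adjBar [Field K] [CharP K 2] (k e : ℕ) (b : ℕ → K) (x : AlgebraicClosure K) : AlgebraicClosure K :=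
  adj k e (fun i => algebraMap K (AlgebraicClosure K) (b i)) x

/-- `F(x) = ∑_{i=0}^{e} b_i x^{p^i}`, with coefficients `b_i ∈ K`, viewed as a function on
the algebraic closure `𝔽` of `K` (with `p = 2^k`). -/
def LpolyBar [Field K] [CharP K 2] (k e : ℕ) (b : ℕ → K) (x : AlgebraicClosure K) : AlgebraicClosure K :=
  Lpoly (2 ^ k) e (fun i => algebraMap K (AlgebraicClosure K) (b i)) x


/-- The set `S_F = {t ∈ 𝔽_q ∣ Q_q(v) = ψ_q(tv) for all v ∈ W_F^*}`. -/
def SF (K : Type*) [Field K] [Fintype K] [CharP K 2] (I : ℂ) (k m e : ℕ) (b : ℕ → K) :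
    Set K :=
  {t : K | ∀ v : K, adjBar k e b (algebraMap K (AlgebraicClosure K) v) = 0 →
    Qq I (k * m) v = psiq (k * m) (t * v)}

/-- The set `S_{F,-} = {t ∈ S_F ∣ Q_q(t) = -(√-1)^{n/2}}`. -/
def SFminus (K : Type*) [Field K] [Fintype K] [CharP K 2] (I : ℂ) (k m e : ℕ) (b : ℕ → K) :
    Set K :=
  {t ∈ SF K I k m e b | Qq I (k * m) t = -I ^ ((k * m) / 2)}

/-- The set `S_{F,+} = {t ∈ S_F ∣ Q_q(t) = (√-1)^{n/2}}`. -/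
def SFplus (K : Type*) [Field K] [Fintype K] [CharP K 2] (I : ℂ) (k m e : ℕ) (b : ℕ → K) :
    Set K :=
  {t ∈ SF K I k m e b | Qq I (k * m) t = I ^ ((k * m) / 2)}

/-- The set `S_0 = 𝔽_q ∖ S_F`. -/
def S0 (K : Type*) [Field K] [Fintype K] [CharP K 2] (I : ℂ) (k m e : ℕ) (b : ℕ → K) :
    Set K :=
  (SF K I k m e b)ᶜ

/-- `T_{R,0}`: the set of `a` with `|C_a(𝔽_q)| = q`, for `R = R_F`. -/
def TR0 (K : Type*) [Field K] [Fintype K] [CharP K 2] (k m e : ℕ) (b : ℕ → K) : Set K :=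
  {a : K | (Ncount K (2 ^ k) (fun x => RF k e b x + a * x) : ℤ) = 2 ^ (k * m)}

/-- `T_{R,max}`: the set of `a` with `|C_a(𝔽_q)| = q + (p-1)pᵉ√q`, for `R = R_F`. -/
def TRmax (K : Type*) [Field K] [Fintype K] [CharP K 2] (k m e : ℕ) (b : ℕ → K) : Set K :=
  {a : K | (Ncount K (2 ^ k) (fun x => RF k e b x + a * x) : ℤ)
      = 2 ^ (k * m) + (2 ^ k - 1) * (2 ^ k) ^ e * 2 ^ ((k * m) / 2)}

/-- `T_{R,min}`: the set of `a` with `|C_a(𝔽_q)| = q - (p-1)pᵉ√q`, for `R = R_F`. -/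
def TRmin (K : Type*) [Field K] [Fintype K] [CharP K 2] (k m e : ℕ) (b : ℕ → K) : Set K :=
  {a : K | (Ncount K (2 ^ k) (fun x => RF k e b x + a * x) : ℤ)
      = 2 ^ (k * m) - (2 ^ k - 1) * (2 ^ k) ^ e * 2 ^ ((k * m) / 2)}

section Helpers

theorem tr2_add [Field K] [CharP K 2] (n : ℕ) (x y : K) :
    tr2 n (x + y) = tr2 n x + tr2 n y := by
  simp only [tr2, ← Finset.sum_add_distrib]
  exact Finset.sum_congr rfl fun i _ => add_pow_char_pow x y 2 i

theorem tr2_zero [Field K] (n : ℕ) : tr2 n (0 : K) = 0 := by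
  simp [tr2]

theorem tr2_sum [Field K] [CharP K 2] {ι : Type*} (n : ℕ) (s : Finset ι) (f : ι → K) :
    tr2 n (∑ i ∈ s, f i) = ∑ i ∈ s, tr2 n (f i) := by
  induction s using Finset.induction_on with
  | empty => simp [tr2_zero]
  | insert a s ha ih => rw [Finset.sum_insert ha, Finset.sum_insert ha, tr2_add, ih]

theorem tr2_sq_add [Field K] [CharP K 2] (n : ℕ) (x : K) :
    tr2 n (x ^ 2 + x) = x ^ 2 ^ n + x := by
  induction n with
  | zero => simp [tr2, CharTwo.add_self_eq_zero]
  | succ n ih =>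
    have h : tr2 (n + 1) (x ^ 2 + x) = tr2 n (x ^ 2 + x) + (x ^ 2 + x) ^ 2 ^ n := by
      simp [tr2, Finset.sum_range_succ]
    rw [h, ih, add_pow_char_pow, ← pow_mul, ← pow_succ']
    linear_combination CharTwo.add_self_eq_zero (x ^ 2 ^ n)

theorem tr2_pow [Field K] [CharP K 2] (n i : ℕ) (x : K) :
    tr2 n (x ^ 2 ^ i) = (tr2 n x) ^ 2 ^ i := by
  simp only [tr2]
  rw [sum_pow_char_pow]
  refine Finset.sum_congr rfl fun j _ => ?_
  rw [← pow_mul, ← pow_mul, mul_comm]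

theorem tr2_sq [Field K] [CharP K 2] (n : ℕ) (x : K) (hx : x ^ 2 ^ n = x) :
    (tr2 n x) ^ 2 = tr2 n x := by
  have h := tr2_sq_add n x
  rw [hx, CharTwo.add_self_eq_zero, tr2_add] at h
  have h2 := tr2_pow n 1 x
  rw [pow_one] at h2
  rw [h2] at h
  exact CharTwo.add_eq_zero.mp h

theorem sq_self_cases [Field K] {x : K} (hx : x ^ 2 = x) : x = 0 ∨ x = 1 := by
  have : x * (x - 1) = 0 := by linear_combination hx
  rcases mul_eq_zero.mp this with h | h
  · exact Or.inl h
  · exact Or.inr (sub_eq_zero.mp h)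

theorem tr2_cases [Field K] [CharP K 2] (n : ℕ) (x : K) (hx : x ^ 2 ^ n = x) :
    tr2 n x = 0 ∨ tr2 n x = 1 := sq_self_cases (tr2_sq n x hx)

theorem tr2_pow_inv [Field K] [CharP K 2] (n i : ℕ) (x : K) (hx : x ^ 2 ^ n = x) :
    tr2 n (x ^ 2 ^ i) = tr2 n x := by
  rw [tr2_pow]
  rcases tr2_cases n x hx with h | h <;> simp [h]

theorem tr2_split [Field K] (a c : ℕ) (x : K) :
    tr2 (a + c) x = tr2 a x + tr2 c (x ^ 2 ^ a) := by
  simp only [tr2, Finset.sum_range_add]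
  congr 1
  refine Finset.sum_congr rfl fun i _ => ?_
  rw [← pow_mul, pow_add]

theorem tr2_mult [Field K] (a nu : ℕ) (x : K) (hx : x ^ 2 ^ a = x) :
    tr2 (nu * a) x = nu * tr2 a x := by
  induction nu with
  | zero => simp [tr2]
  | succ nu ih =>
    rw [Nat.succ_mul, add_comm, tr2_split, hx, ih]
    push_cast; ring

theorem W2.ext' {R : Type*} {x y : W2 R} (h1 : x.1 = y.1) (h2 : x.2 = y.2) : x = y :=
  Prod.ext h1 h2

/-- Constructor for `W2`. -/
def W2.mk' {R : Type*} (x y : R) : W2 R := ((x, y) : R × R)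

theorem W2.mk_fst {R : Type*} (x y : R) : (W2.mk' x y).1 = x := rfl

theorem W2.mk_snd {R : Type*} (x y : R) : (W2.mk' x y).2 = y := rfl

theorem W2.frob_iter {R : Type*} [CommRing R] (i : ℕ) (x : W2 R) :
    W2.frob^[i] x = W2.mk' (x.1 ^ 2 ^ i) (x.2 ^ 2 ^ i) := by
  induction i generalizing x with
  | zero => apply W2.ext' <;> simp [W2.mk_fst, W2.mk_snd]
  | succ i ih =>
    rw [Function.iterate_succ_apply, ih]
    apply W2.ext' <;> simp only [W2.frob, W2.mk_fst, W2.mk_snd, ← pow_mul, ← pow_succ']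

theorem W2.frob_iter_add [Field K] [CharP K 2] (i : ℕ) (x y : W2 K) :
    W2.frob^[i] (x + y) = W2.frob^[i] x + W2.frob^[i] y := by
  simp only [W2.frob_iter]
  apply W2.ext'
  · simp only [W2.fst_add, W2.mk_fst, W2.mk_snd]; exact add_pow_char_pow _ _ 2 i
  · simp only [W2.fst_add, W2.snd_add, W2.mk_fst, W2.mk_snd]
    rw [add_pow_char_pow, add_pow_char_pow, mul_pow]

theorem W2.tr_add [Field K] [CharP K 2] (n : ℕ) (x y : W2 K) :
    W2.tr n (x + y) = W2.tr n x + W2.tr n y := by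
  simp only [W2.tr, ← Finset.sum_add_distrib]
  exact Finset.sum_congr rfl fun i _ => W2.frob_iter_add i x y

theorem W2.tr_split [Field K] [CharP K 2] (a c : ℕ) (x : W2 K) :
    W2.tr (a + c) x = W2.tr a x + W2.tr c (W2.frob^[a] x) := by
  simp only [W2.tr, Finset.sum_range_add]
  congr 1
  refine Finset.sum_congr rfl fun i _ => ?_
  rw [add_comm, Function.iterate_add_apply]

theorem W2.tr_mult [Field K] [CharP K 2] (a nu : ℕ) (x : W2 K) (hx : W2.frob^[a] x = x) :
    W2.tr (nu * a) x = nu • W2.tr a x := by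
  induction nu with
  | zero => simp [W2.tr]
  | succ nu ih =>
    rw [Nat.succ_mul, add_comm, W2.tr_split, hx, ih, succ_nsmul']

theorem W2.tr_fst [Field K] [CharP K 2] (n : ℕ) (x : W2 K) : (W2.tr n x).1 = tr2 n x.1 := by
  induction n with
  | zero => simp [W2.tr, tr2, W2.fst_zero]
  | succ n ih =>
    have h1 : W2.tr (n + 1) x = W2.tr n x + W2.frob^[n] x := by
      simp [W2.tr, Finset.sum_range_succ]
    have h2 : tr2 (n + 1) x.1 = tr2 n x.1 + x.1 ^ 2 ^ n := by
      simp [tr2, Finset.sum_range_succ]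
    rw [h1, h2, W2.fst_add, ih, W2.frob_iter]; rfl

theorem W2.tr_V [Field K] [CharP K 2] (n : ℕ) (z : K) :
    W2.tr n (W2.mk' 0 z) = W2.mk' 0 (tr2 n z) := by
  induction n with
  | zero => simp [W2.tr, tr2]; rfl
  | succ n ih =>
    have h1 : W2.tr (n + 1) (W2.mk' 0 z) = W2.tr n (W2.mk' 0 z) + W2.frob^[n] (W2.mk' 0 z) := by
      simp [W2.tr, Finset.sum_range_succ]
    have h2 : tr2 (n + 1) z = tr2 n z + z ^ 2 ^ n := by
      simp [tr2, Finset.sum_range_succ]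
    rw [h1, h2, ih, W2.frob_iter]
    apply W2.ext'
    · simp [W2.fst_add, W2.mk_fst, W2.mk_snd]
    · simp [W2.snd_add, W2.mk_fst, W2.mk_snd]

/-- Both components lie in the prime field. -/
def W2.Is01 [Field K] (x : W2 K) : Prop := x.1 ^ 2 = x.1 ∧ x.2 ^ 2 = x.2

theorem W2.Is01.add [Field K] [CharP K 2] {x y : W2 K} (hx : x.Is01) (hy : y.Is01) :
    (x + y).Is01 := by
  obtain ⟨a, c⟩ := hx
  obtain ⟨a', c'⟩ := hy
  constructor
  · rw [W2.fst_add, add_pow_char, a, a']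
  · rw [W2.snd_add, add_pow_char, add_pow_char, mul_pow, a, a', c, c']

theorem W2.Is01.zero [Field K] : (0 : W2 K).Is01 := by
  constructor <;> simp [W2.fst_zero, W2.snd_zero]

theorem W2.Is01.nsmul [Field K] [CharP K 2] {x : W2 K} (hx : x.Is01) (n : ℕ) :
    (n • x).Is01 := by
  induction n with
  | zero => rw [zero_nsmul]; exact W2.Is01.zero
  | succ n ih => rw [succ_nsmul]; exact ih.add hx

theorem W2.xi_add [Field K] [CharP K 2] {I : ℂ} (hI : I ^ 2 = -1) {x y : W2 K}
    (hx : x.Is01) (hy : y.Is01) : W2.xi I (x + y) = W2.xi I x * W2.xi I y := by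
  have h11 : (1 : K) + 1 = 0 := CharTwo.add_self_eq_zero 1
  obtain ⟨x1, x2⟩ := x
  obtain ⟨y1, y2⟩ := y
  have e1 := W2.fst_add ((x1, x2) : W2 K) (y1, y2)
  have e2 := W2.snd_add ((x1, x2) : W2 K) (y1, y2)
  simp only at e1 e2
  simp only [W2.xi]
  rw [e1, e2]
  rcases sq_self_cases hx.1 with h | h <;> rcases sq_self_cases hx.2 with h' | h' <;>
  rcases sq_self_cases hy.1 with g | g <;> rcases sq_self_cases hy.2 with g' | g' <;>
  simp only at h h' g g' <;> subst h h' g g' <;> simp [h11] <;> first | linear_combination -hI | linear_combination hI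

theorem W2.xi_zero [Field K] (I : ℂ) : W2.xi I (0 : W2 K) = 1 := by
  simp [W2.xi, W2.fst_zero, W2.snd_zero]

theorem W2.xi_nsmul [Field K] [CharP K 2] {I : ℂ} (hI : I ^ 2 = -1) {x : W2 K}
    (hx : x.Is01) (n : ℕ) : W2.xi I (n • x) = W2.xi I x ^ n := by
  induction n with
  | zero => rw [zero_nsmul, W2.xi_zero, pow_zero]
  | succ n ih => rw [succ_nsmul, W2.xi_add hI (hx.nsmul n) hx, ih, pow_succ]

theorem W2.frob_sum [Field K] [CharP K 2] (n : ℕ) (x : W2 K) :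
    W2.frob (W2.tr n x) = W2.tr n (W2.frob x) := by
  have hz : W2.frob (0 : W2 K) = 0 := by
    apply W2.ext' <;> simp [W2.frob, W2.fst_zero, W2.snd_zero]
  induction n with
  | zero => simpa [W2.tr] using hz
  | succ n ih =>
    have h1 : ∀ x : W2 K, W2.tr (n + 1) x = W2.tr n x + W2.frob^[n] x := by
      intro x
      simp [W2.tr, Finset.sum_range_succ]
    have ha := W2.frob_iter_add 1 (W2.tr n x) (W2.frob^[n] x)
    simp only [Function.iterate_one] at ha
    rw [h1, h1, ha, ih, ← Function.iterate_succ_apply' W2.frob, Function.iterate_succ_apply]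

theorem W2.tr_frob [Field K] [CharP K 2] (n : ℕ) (x : W2 K) (hx : W2.frob^[n] x = x) :
    W2.tr n (W2.frob x) = W2.tr n x := by
  have h1 := W2.tr_split n 1 x
  have h2 := W2.tr_split 1 n x
  rw [add_comm 1 n, h1, hx, Function.iterate_one, add_comm] at h2
  exact (add_left_cancel h2).symm

theorem W2.tr_is01 [Field K] [CharP K 2] (n : ℕ) (x : W2 K) (hx : W2.frob^[n] x = x) :
    (W2.tr n x).Is01 := by
  have h := (W2.frob_sum n x).trans (W2.tr_frob n x hx)
  exact ⟨congrArg Prod.fst h, congrArg Prod.snd h⟩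

theorem W2.frob_iter_fix [Field K] (n : ℕ) (hn : ∀ x : K, x ^ 2 ^ n = x) (x : W2 K) :
    W2.frob^[n] x = x := by
  rw [W2.frob_iter, hn, hn]; rfl

theorem psiq_add [Field K] [CharP K 2] {n : ℕ} (hn : ∀ x : K, x ^ 2 ^ n = x) (x y : K) :
    psiq n (x + y) = psiq n x * psiq n y := by
  have h11 : (1 : K) + 1 = 0 := CharTwo.add_self_eq_zero 1
  simp only [psiq, tr2_add]
  rcases tr2_cases n x (hn x) with h | h <;> rcases tr2_cases n y (hn y) with g | g <;>
  simp [h, g, h11]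

theorem psiq_zero [Field K] (n : ℕ) : psiq n (0 : K) = 1 := by
  simp [psiq, tr2_zero]

theorem psiq_congr [Field K] {n : ℕ} {x y : K} (h : tr2 n x = tr2 n y) :
    psiq n x = psiq n y := by
  simp only [psiq, h]

theorem psiq_sq [Field K] (n : ℕ) (x : K) : psiq n x * psiq n x = 1 := by
  simp only [psiq]; split_ifs <;> norm_num

theorem psiq_cases [Field K] (n : ℕ) (x : K) : psiq n x = 1 ∨ psiq n x = -1 := by
  simp only [psiq]; split_ifs <;> simp

theorem xi_V [Field K] (I : ℂ) (n : ℕ) (z : K) :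
    W2.xi I (W2.mk' 0 (tr2 n z)) = psiq n z := by
  simp only [W2.xi, W2.mk_fst, W2.mk_snd, psiq]
  split_ifs <;> simp_all

theorem Qq_add [Field K] [CharP K 2] {I : ℂ} (hI : I ^ 2 = -1) {n : ℕ}
    (hn : ∀ x : K, x ^ 2 ^ n = x) (x y : K) :
    Qq I n (x + y) = Qq I n x * Qq I n y * psiq n (x * y) := by
  have h01 : ∀ z : W2 K, (W2.tr n z).Is01 := fun z => W2.tr_is01 n z (W2.frob_iter_fix n hn z)
  have e1 : (W2.mk' x 0 + W2.mk' y 0 : W2 K) = W2.mk' (x + y) 0 + W2.mk' 0 (x * y) := by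
    apply W2.ext' <;> simp [W2.fst_add, W2.snd_add, W2.mk_fst, W2.mk_snd]
  have e2 := congrArg (fun z => W2.xi I (W2.tr n z)) e1
  simp only [W2.tr_add] at e2
  rw [W2.xi_add hI (h01 _) (h01 _), W2.xi_add hI (h01 _) (h01 _), W2.tr_V, xi_V] at e2
  have e3 : ∀ z : K, Qq I n z = W2.xi I (W2.tr n (W2.mk' z 0)) := fun z => rfl
  rw [e3, e3, e3, e2, mul_assoc, psiq_sq, mul_one]

theorem Qq_pow [Field K] [CharP K 2] (I : ℂ) {n : ℕ}
    (hn : ∀ x : K, x ^ 2 ^ n = x) (i : ℕ) (x : K) : Qq I n (x ^ 2 ^ i) = Qq I n x := by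
  induction i with
  | zero => simp
  | succ i ih =>
    rw [← ih, pow_succ, pow_mul]
    have h := W2.tr_frob n (W2.mk' (x ^ 2 ^ i) 0) (W2.frob_iter_fix n hn _)
    simp only [W2.frob, W2.mk', ne_eq, OfNat.ofNat_ne_zero, not_false_eq_true, zero_pow] at h
    exact congrArg (W2.xi I) h

theorem Qq_zero [Field K] [CharP K 2] (I : ℂ) (n : ℕ) : Qq I n (0 : K) = 1 := by
  have h := W2.tr_V n (0 : K)
  have e3 : Qq I n (0 : K) = W2.xi I (W2.tr n (W2.mk' (0 : K) 0)) := rfl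
  rw [e3, h, xi_V, psiq_zero]

theorem Qq_ne_zero [Field K] [CharP K 2] {I : ℂ} (hI : I ^ 2 = -1) (n : ℕ) (x : K) :
    Qq I n x ≠ 0 := by
  have : I ≠ 0 := by rintro rfl; norm_num at hI
  simp only [Qq, W2.xi]
  split_ifs <;> simp [this]

theorem Qq_t0 [Field K] [CharP K 2] {I : ℂ} (hI : I ^ 2 = -1) (h nu : ℕ) (t : K)
    (ht : t ^ 2 ^ h + t = 1) : Qq I (nu * (2 * h)) t = (-I ^ h) ^ nu := by
  have h11 : (1 : K) + 1 = 0 := CharTwo.add_self_eq_zero 1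
  have ht' : t ^ 2 ^ h = t + 1 := by
    linear_combination ht - CharTwo.add_self_eq_zero t
  have htt : t ^ 2 ^ (2 * h) = t := by
    rw [two_mul, pow_add, pow_mul, ht', add_pow_char_pow, ht', one_pow, add_assoc, h11, add_zero]
  have e0 : Qq I (nu * (2 * h)) t = W2.xi I (W2.tr (nu * (2 * h)) (W2.mk' t 0)) := rfl
  have e1 : W2.tr (2 * h) (W2.mk' t 0) = h • W2.mk' 1 0 + W2.mk' 0 1 := by
    rw [two_mul, W2.tr_split, ← W2.tr_add, W2.frob_iter]
    have : (W2.mk' t 0 + W2.mk' ((W2.mk' t 0).1 ^ 2 ^ h) ((W2.mk' t 0).2 ^ 2 ^ h) : W2 K)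
        = W2.mk' 1 0 + W2.mk' 0 (t ^ 2 + t) := by
      apply W2.ext'
      · simp only [W2.fst_add, W2.mk_fst, W2.mk_snd, ht']
        linear_combination CharTwo.add_self_eq_zero t
      · simp [W2.snd_add, W2.mk_fst, W2.mk_snd, ht']
        ring
    rw [this, W2.tr_add, W2.tr_V, tr2_sq_add, ht]
    congr 1
    simp only [W2.tr, W2.frob_iter, W2.mk_fst, W2.mk_snd, one_pow]
    simp
  have i1 : (W2.mk' 1 0 : W2 K).Is01 := by constructor <;> simp [W2.mk']
  have i2 : (W2.mk' 0 1 : W2 K).Is01 := by constructor <;> simp [W2.mk']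
  rw [e0, W2.tr_mult, e1, W2.xi_nsmul hI ((i1.nsmul h).add i2), W2.xi_add hI (i1.nsmul h) i2,
    W2.xi_nsmul hI i1]
  · simp [W2.xi, W2.mk_fst, W2.mk_snd]
  · rw [W2.frob_iter]
    apply W2.ext' <;> simp [W2.mk_fst, W2.mk_snd, htt]

theorem Qq_fixed [Field K] [CharP K 2] (I : ℂ) (h nu : ℕ) (t v : K)
    (ht : t ^ 2 ^ h + t = 1) (hv : v ^ 2 ^ h = v) :
    Qq I (nu * (2 * h)) v = psiq (nu * (2 * h)) (t * v) := by
  have h11 : (1 : K) + 1 = 0 := CharTwo.add_self_eq_zero 1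
  have ht' : t ^ 2 ^ h = t + 1 := by
    linear_combination ht - CharTwo.add_self_eq_zero t
  have htt : t ^ 2 ^ (2 * h) = t := by
    rw [two_mul, pow_add, pow_mul, ht', add_pow_char_pow, ht', one_pow, add_assoc, h11, add_zero]
  have hvv : v ^ 2 ^ (2 * h) = v := by
    rw [two_mul, pow_add, pow_mul, hv, hv]
  have e0 : Qq I (nu * (2 * h)) v = W2.xi I (W2.tr (nu * (2 * h)) (W2.mk' v 0)) := rfl
  have e1 : W2.tr (2 * h) (W2.mk' v 0) = W2.mk' 0 (tr2 h v) := by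
    rw [two_mul, W2.tr_split]
    have : W2.frob^[h] (W2.mk' v 0) = W2.mk' v 0 := by
      rw [W2.frob_iter]; apply W2.ext' <;> simp [W2.mk_fst, W2.mk_snd, hv]
    rw [this]
    have hf := W2.tr_fst h (W2.mk' v 0)
    apply W2.ext'
    · rw [W2.fst_add, CharTwo.add_self_eq_zero]; rfl
    · rw [W2.snd_add, CharTwo.add_self_eq_zero, hf, zero_add, ← sq]
      exact tr2_sq h v hv
  have e2 : tr2 (2 * h) (t * v) = tr2 h v := by
    rw [two_mul, tr2_split, ← tr2_add, mul_pow, hv, ht']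
    congr 1
    linear_combination v * CharTwo.add_self_eq_zero t
  have e3 : ∀ c : K, nu • W2.mk' 0 c = W2.mk' 0 (nu * c) := by
    intro c
    induction nu with
    | zero => simp; rfl
    | succ nu ih =>
      rw [succ_nsmul]
      have ih := ih rfl
      rw [ih]
      apply W2.ext'
      · simp [W2.fst_add, W2.mk_fst, W2.mk_snd]
      · simp [W2.snd_add, W2.mk_fst, W2.mk_snd]; ring
  rw [e0, W2.tr_mult, e1, e3, ← e2, ← tr2_mult, xi_V]
  · rw [mul_pow, htt, hvv]
  · rw [W2.frob_iter]
    apply W2.ext' <;> simp [W2.mk_fst, W2.mk_snd, hvv]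

theorem exists_tr2_ne [Field K] [Fintype K] [CharP K 2] {n : ℕ}
    (hcard : Fintype.card K = 2 ^ n) : ∃ z : K, tr2 n z ≠ 0 := by
  let _ : Algebra (ZMod 2) K := ZMod.algebra K 2
  have : Fact (Nat.Prime 2) := ⟨Nat.prime_two⟩
  obtain ⟨z, hz⟩ := Algebra.trace_surjective (ZMod 2) K 1
  refine ⟨z, ?_⟩
  have h := FiniteField.algebraMap_trace_eq_sum_pow (ZMod 2) K z
  have hf : Module.finrank (ZMod 2) K = n := by
    have h2 := Module.card_eq_pow_finrank (K := ZMod 2) (V := K)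
    rw [hcard, ZMod.card] at h2
    exact (Nat.pow_right_injective le_rfl h2).symm
  rw [hz, map_one, hf, Nat.card_eq_fintype_card, ZMod.card] at h
  simp only [tr2]
  rw [← h]
  exact one_ne_zero

theorem pow_card' [Field K] [Fintype K] {n : ℕ}
    (hcard : Fintype.card K = 2 ^ n) (x : K) : x ^ 2 ^ n = x := by
  rw [← hcard, FiniteField.pow_card]

theorem sum_psiq [Field K] [Fintype K] [CharP K 2] {n : ℕ}
    (hcard : Fintype.card K = 2 ^ n) (c : K) :
    ∑ x : K, psiq n (c * x) = if c = 0 then (2 : ℂ) ^ n else 0 := by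
  split_ifs with h
  · simp [h, psiq_zero, hcard]
  · obtain ⟨z, hz⟩ := exists_tr2_ne hcard
    have h1 : ∑ x : K, psiq n (c * (x + c⁻¹ * z)) = ∑ x : K, psiq n (c * x) :=
      Equiv.sum_comp (Equiv.addRight (c⁻¹ * z)) fun x => psiq n (c * x)
    have hz' : psiq n z = -1 := by simp [psiq, hz]
    have h2 : ∀ x : K, psiq n (c * (x + c⁻¹ * z)) = - psiq n (c * x) := by
      intro x
      rw [mul_add, mul_inv_cancel_left₀ h, psiq_add (pow_card' hcard), hz']
      ring
    simp only [h2, Finset.sum_neg_distrib] at h1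
    have h3 : (2 : ℂ) * ∑ x : K, psiq n (c * x) = 0 := by linear_combination -h1
    simpa using h3

theorem fiber_card [Field K] [Fintype K] [CharP K 2] {n : ℕ}
    (hcard : Fintype.card K = 2 ^ n) (f f' : K → K)
    (hadj : ∀ x y, tr2 n (f x * y) = tr2 n (x * f' y)) (y : K) :
    (((Finset.univ.filter fun x => f x = y).card : ℕ) : ℂ)
      = ∑ w ∈ Finset.univ.filter (fun w => f' w = 0), psiq n (w * y) := by
  have hn := pow_card' hcard
  have h0 : (2 : ℂ) ^ n ≠ 0 := pow_ne_zero _ two_ne_zero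
  have hL : (2 : ℂ) ^ n * (((Finset.univ.filter fun x => f x = y).card : ℕ) : ℂ)
      = ∑ x : K, ∑ v : K, psiq n ((f x + y) * v) := by
    rw [Finset.card_filter]
    push_cast
    rw [Finset.mul_sum]
    refine Finset.sum_congr rfl fun x _ => ?_
    rw [sum_psiq hcard]
    simp only [CharTwo.add_eq_zero]
    split_ifs <;> simp
  have hR : (2 : ℂ) ^ n * ∑ w ∈ Finset.univ.filter (fun w => f' w = 0), psiq n (w * y)
      = ∑ v : K, ∑ x : K, psiq n ((f x + y) * v) := by
    rw [Finset.sum_filter, Finset.mul_sum]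
    refine Finset.sum_congr rfl fun v _ => ?_
    have : ∀ x : K, psiq n ((f x + y) * v) = psiq n (v * y) * psiq n (f' v * x) := by
      intro x
      rw [add_mul, psiq_add hn, psiq_congr (hadj x v), mul_comm y v, mul_comm x, mul_comm]
    simp only [this, ← Finset.mul_sum, sum_psiq hcard]
    split_ifs <;> simp [mul_comm]
  apply mul_left_cancel₀ h0
  rw [hL, hR, Finset.sum_comm]

theorem ker_card_eq [Field K] [Fintype K] [CharP K 2] {n : ℕ}
    (hcard : Fintype.card K = 2 ^ n) (f f' : K → K)
    (hadj : ∀ x y, tr2 n (f x * y) = tr2 n (x * f' y)) :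
    (Finset.univ.filter fun x => f x = 0).card = (Finset.univ.filter fun x => f' x = 0).card := by
  have h := fiber_card hcard f f' hadj 0
  simp only [mul_zero, psiq_zero, Finset.sum_const, nsmul_eq_mul, mul_one] at h
  exact_mod_cast h

theorem mem_range_of_perp [Field K] [Fintype K] [CharP K 2] {n : ℕ}
    (hcard : Fintype.card K = 2 ^ n) (f f' : K → K)
    (hadj : ∀ x y, tr2 n (f x * y) = tr2 n (x * f' y)) (h0 : f' 0 = 0) (y : K)
    (hy : ∀ w, f' w = 0 → psiq n (w * y) = 1) : ∃ x, f x = y := by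
  have h := fiber_card hcard f f' hadj y
  rw [Finset.sum_congr rfl (g := fun _ => (1 : ℂ))
    (fun w hw => hy w (Finset.mem_filter.mp hw).2)] at h
  simp only [Finset.sum_const, nsmul_eq_mul, mul_one] at h
  have h2 : (Finset.univ.filter fun x => f x = y).card
    = (Finset.univ.filter fun x => f' x = 0).card := by exact_mod_cast h
  have h3 : 0 < (Finset.univ.filter fun x => f x = y).card := by
    rw [h2]
    exact Finset.card_pos.mpr ⟨0, by simp [h0]⟩
  obtain ⟨x, hx⟩ := Finset.card_pos.mp h3
  exact ⟨x, (Finset.mem_filter.mp hx).2⟩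

theorem sum_comp_eq [Field K] [Fintype K] [CharP K 2] {n : ℕ}
    (hcard : Fintype.card K = 2 ^ n) (f f' : K → K)
    (hadj : ∀ x y, tr2 n (f x * y) = tr2 n (x * f' y)) (g : K → ℂ)
    (hg : ∀ y w, f' w = 0 → g (y + w) = g y * psiq n (w * y)) :
    ∑ x, g (f x) = ((Finset.univ.filter fun x => f x = 0).card : ℂ) * ∑ y, g y := by
  have h1 : ∑ x, g (f x) = ∑ y, ((Finset.univ.filter fun x => f x = y).card : ℂ) * g y := by
    rw [← Finset.sum_fiberwise (s := Finset.univ) (g := f)]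
    refine Finset.sum_congr rfl fun y _ => ?_
    rw [Finset.sum_congr rfl (g := fun _ => g y)
      (fun x hx => by rw [(Finset.mem_filter.mp hx).2])]
    simp
  rw [h1, ker_card_eq hcard f f' hadj]
  simp only [fiber_card hcard f f' hadj, Finset.sum_mul]
  rw [Finset.sum_comm, ← nsmul_eq_mul, ← Finset.sum_const]
  refine Finset.sum_congr rfl fun w hw => ?_
  rw [← Equiv.sum_comp (Equiv.addRight w) g]
  refine Finset.sum_congr rfl fun y _ => ?_
  rw [Equiv.coe_addRight, hg y w (Finset.mem_filter.mp hw).2, mul_comm]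

theorem mem_range_of_pow [Field K] [Fintype K] {n : ℕ}
    (hcard : Fintype.card K = 2 ^ n) (x : AlgebraicClosure K) (hx : x ^ 2 ^ n = x) :
    x ∈ Set.range (algebraMap K (AlgebraicClosure K)) := by
  have hr := FiniteField.roots_X_pow_card_sub_X K
  have h1 := FiniteField.X_pow_card_sub_X_natDegree_eq K (Fintype.one_lt_card (α := K))
  have hs : (Polynomial.X ^ Fintype.card K - Polynomial.X : Polynomial K).Splits := by
    rw [Polynomial.splits_iff_card_roots, hr, h1]
    rfl
  have h2 := hs.roots_map (algebraMap K (AlgebraicClosure K))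
  have hne : (Polynomial.X ^ Fintype.card K - Polynomial.X : Polynomial (AlgebraicClosure K)) ≠ 0 :=
    FiniteField.X_pow_card_sub_X_ne_zero _ (Fintype.one_lt_card (α := K))
  have h3 : x ∈ (Polynomial.X ^ Fintype.card K - Polynomial.X :
      Polynomial (AlgebraicClosure K)).roots := by
    rw [Polynomial.mem_roots hne]
    simp [hcard, hx]
  simp only [Polynomial.map_sub, Polynomial.map_pow, Polynomial.map_X] at h2
  rw [h2, hr] at h3
  obtain ⟨y, _, hy⟩ := Multiset.mem_map.mp h3
  exact ⟨y, hy⟩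

theorem pow_iter_fix [Field K] (a nu : ℕ) (x : K) (hx : x ^ 2 ^ a = x) : x ^ 2 ^ (nu * a) = x := by
  induction nu with
  | zero => simp
  | succ nu ih => rw [Nat.succ_mul, pow_add, pow_mul, ih, hx]

theorem Lpoly_card [Field K] [Fintype K] [CharP K 2] (k e : ℕ) (hk : 1 ≤ k) (b : ℕ → K)
    (hb1 : b 0 * b e ≠ 0)
    (hr : ∀ x : AlgebraicClosure K,
      Lpoly (2 ^ k) e (fun i => algebraMap K (AlgebraicClosure K) (b i)) x = 0 →
      x ∈ Set.range (algebraMap K (AlgebraicClosure K))) :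
    (Finset.univ.filter fun x : K => Lpoly (2 ^ k) e b x = 0).card = (2 ^ k) ^ e := by
  have hb0 : b 0 ≠ 0 := left_ne_zero_of_mul hb1
  have hbe : b e ≠ 0 := right_ne_zero_of_mul hb1
  have hk2 : 1 < 2 ^ k := Nat.one_lt_two_pow (by omega)
  set P : Polynomial K := ∑ i ∈ Finset.range (e + 1),
    Polynomial.C (b i) * Polynomial.X ^ (2 ^ k) ^ i with hP
  have heval : ∀ x, Polynomial.aeval x P =
      Lpoly (2 ^ k) e (fun i => algebraMap K (AlgebraicClosure K) (b i)) x := by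
    intro x
    simp [hP, Lpoly, map_sum]
  have heval' : ∀ x, Polynomial.eval x P = Lpoly (2 ^ k) e b x := by
    intro x
    simp [hP, Lpoly, Polynomial.eval_finsetSum]
  have hdeg : P.natDegree = (2 ^ k) ^ e := by
    rw [hP, Finset.sum_range_succ]
    have hlead : (Polynomial.C (b e) * Polynomial.X ^ (2 ^ k) ^ e).degree
        = (((2 ^ k) ^ e : ℕ) : WithBot ℕ) := by
      rw [Polynomial.degree_C_mul_X_pow _ hbe]
    have hlt : (∑ i ∈ Finset.range e, Polynomial.C (b i) * Polynomial.X ^ (2 ^ k) ^ i).degree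
        < (Polynomial.C (b e) * Polynomial.X ^ (2 ^ k) ^ e).degree := by
      rw [hlead]
      refine lt_of_le_of_lt (Polynomial.degree_sum_le _ _) ?_
      rw [Finset.sup_lt_iff (WithBot.bot_lt_coe _)]
      intro i hi
      refine lt_of_le_of_lt (Polynomial.degree_C_mul_X_pow_le _ _) ?_
      exact_mod_cast Nat.pow_lt_pow_right hk2 (Finset.mem_range.mp hi)
    apply Polynomial.natDegree_eq_of_degree_eq_some
    rw [Polynomial.degree_add_eq_right_of_degree_lt hlt, hlead]
  have hder : Polynomial.derivative P = Polynomial.C (b 0) := by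
    rw [hP, Finset.sum_range_succ', Polynomial.derivative_add, Polynomial.derivative_sum]
    rw [Finset.sum_eq_zero]
    · simp
    · intro i _
      rw [Polynomial.derivative_C_mul_X_pow]
      have : (((2 ^ k) ^ (i + 1) : ℕ) : K) = 0 := by
        push_cast
        rw [CharTwo.two_eq_zero, zero_pow (by omega), zero_pow (by omega)]
      rw [this]; simp
  have hsep : P.Separable := by
    rw [Polynomial.Separable, hder]
    refine ⟨0, Polynomial.C (b 0)⁻¹, ?_⟩
    rw [zero_mul, zero_add, ← Polynomial.C_mul, inv_mul_cancel₀ hb0, Polynomial.C_1]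
  have hP0 : P ≠ 0 := by
    intro h
    rw [h] at hdeg
    have : 0 < (2 ^ k) ^ e := by positivity
    simp at hdeg
    omega
  have hc := Polynomial.card_rootSet_eq_natDegree (K := AlgebraicClosure K) hsep
    (IsAlgClosed.splits _)
  rw [← hdeg, ← hc, ← Set.toFinset_card]
  refine Finset.card_bij (fun x _ => algebraMap K (AlgebraicClosure K) x) ?_ ?_ ?_
  · intro x hx
    rw [Set.mem_toFinset, Polynomial.mem_rootSet]
    refine ⟨hP0, ?_⟩
    rw [Polynomial.aeval_algebraMap_apply, Polynomial.coe_aeval_eq_eval, heval',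
      (Finset.mem_filter.mp hx).2, map_zero]
  · intro x _ y _ h
    exact (algebraMap K (AlgebraicClosure K)).injective h
  · intro y hy
    rw [Set.mem_toFinset, Polynomial.mem_rootSet] at hy
    have h2 := hy.2
    obtain ⟨x, rfl⟩ := hr y (by rw [← heval]; exact h2)
    refine ⟨x, ?_, rfl⟩
    rw [Polynomial.aeval_algebraMap_apply, Polynomial.coe_aeval_eq_eval, heval'] at h2
    simp only [Finset.mem_filter, Finset.mem_univ, true_and]
    exact (map_eq_zero _).mp h2

/-- Kernel of `x ↦ x^{2^h} + x`. -/
theorem fix_card [Field K] [Fintype K] [CharP K 2] {n : ℕ}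
    (hcard : Fintype.card K = 2 ^ n) (h c : ℕ) (hh : 1 ≤ h) (hn : n = c * h) :
    (Finset.univ.filter fun x : K => x ^ 2 ^ h + x = 0).card = 2 ^ h := by
  have h1 := Lpoly_card (K := K) h 1 hh (fun _ => 1) (by simp) (by
    intro x hx
    apply mem_range_of_pow hcard
    rw [hn]
    apply pow_iter_fix
    simp [Lpoly, Finset.sum_range_succ] at hx
    rw [add_comm] at hx
    exact CharTwo.add_eq_zero.mp hx)
  rw [pow_one] at h1
  refine Eq.trans ?_ h1
  congr 1
  ext x
  simp [Lpoly, Finset.sum_range_succ, add_comm]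

theorem rt_pow {L : Type*} [Field L] [ExpChar L 2] [PerfectRing L 2] (j : ℕ) (x : L) :
    (rt L j x) ^ 2 ^ j = x :=
  iterate_frobeniusEquiv_symm_pow_p_pow L 2 x j

theorem pow_two_inj [Field K] [CharP K 2] (j : ℕ) {x y : K} (h : x ^ 2 ^ j = y ^ 2 ^ j) :
    x = y := by
  have h1 : (x + y) ^ 2 ^ j = 0 := by
    rw [add_pow_char_pow, h, CharTwo.add_self_eq_zero]
  exact CharTwo.add_eq_zero.mp (eq_zero_of_pow_eq_zero h1)

theorem rt_add [Field K] [CharP K 2] [PerfectRing K 2] (j : ℕ) (x y : K) :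
    rt K j (x + y) = rt K j x + rt K j y := by
  apply pow_two_inj j
  rw [add_pow_char_pow, rt_pow, rt_pow, rt_pow]

theorem rt_map {L M : Type*} [Field L] [CharP L 2] [PerfectRing L 2] [Field M] [CharP M 2]
    [PerfectRing M 2] (φ : L →+* M) (j : ℕ) (x : L) : rt M j (φ x) = φ (rt L j x) := by
  apply pow_two_inj j
  rw [rt_pow, ← map_pow, rt_pow]

theorem adjBar_map [Field K] [CharP K 2] [PerfectRing K 2] (k e : ℕ) (b : ℕ → K) (v : K) :
    adjBar k e b (algebraMap K (AlgebraicClosure K) v)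
      = algebraMap K (AlgebraicClosure K) (adj k e b v) := by
  simp only [adjBar, adj, map_sum]
  refine Finset.sum_congr rfl fun i _ => ?_
  rw [← map_mul, rt_map]

theorem adj_add [Field K] [CharP K 2] [PerfectRing K 2] (k e : ℕ) (b : ℕ → K) (x y : K) :
    adj k e b (x + y) = adj k e b x + adj k e b y := by
  simp only [adj, mul_add, rt_add, Finset.sum_add_distrib]

theorem adj_zero [Field K] [CharP K 2] [PerfectRing K 2] (k e : ℕ) (b : ℕ → K) :
    adj k e b 0 = 0 := by
  have h := adj_add k e b 0 0
  rw [add_zero] at h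
  exact left_eq_add.mp h

theorem Lpoly_add [Field K] [CharP K 2] (k e : ℕ) (b : ℕ → K) (x y : K) :
    Lpoly (2 ^ k) e b (x + y) = Lpoly (2 ^ k) e b x + Lpoly (2 ^ k) e b y := by
  simp only [Lpoly, ← Finset.sum_add_distrib, ← pow_mul]
  refine Finset.sum_congr rfl fun i _ => ?_
  rw [add_pow_char_pow, mul_add]

theorem adj_hadj [Field K] [CharP K 2] [PerfectRing K 2] {n : ℕ}
    (hn : ∀ x : K, x ^ 2 ^ n = x) (k e : ℕ) (b : ℕ → K) (x y : K) :
    tr2 n (Lpoly (2 ^ k) e b x * y) = tr2 n (x * adj k e b y) := by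
  simp only [Lpoly, adj, Finset.sum_mul, Finset.mul_sum, tr2_sum]
  refine Finset.sum_congr rfl fun i _ => ?_
  rw [← tr2_pow_inv n (k * i) (x * _) (hn _), mul_pow, rt_pow, ← pow_mul]
  congr 1
  ring

theorem Qq_sum [Field K] [CharP K 2] {I : ℂ} (hI : I ^ 2 = -1) {n : ℕ}
    (hn : ∀ x : K, x ^ 2 ^ n = x) (N : ℕ) (c : ℕ → K) :
    Qq I n (∑ i ∈ Finset.range N, c i) = (∏ i ∈ Finset.range N, Qq I n (c i)) *
      psiq n (∑ i ∈ Finset.range N, ∑ l ∈ Finset.Ioo i N, c i * c l) := by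
  induction N with
  | zero => simp [Qq_zero, psiq_zero]
  | succ N ih =>
    have h1 : ∑ i ∈ Finset.range (N + 1), ∑ l ∈ Finset.Ioo i (N + 1), c i * c l
        = (∑ i ∈ Finset.range N, ∑ l ∈ Finset.Ioo i N, c i * c l)
          + (∑ i ∈ Finset.range N, c i) * c N := by
      rw [Finset.sum_range_succ]
      have : Finset.Ioo N (N + 1) = ∅ := by ext; simp
      rw [this, Finset.sum_empty, add_zero, Finset.sum_mul, ← Finset.sum_add_distrib]
      refine Finset.sum_congr rfl fun i hi => ?_
      have hi' := Finset.mem_range.mp hi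
      have : Finset.Ioo i (N + 1) = insert N (Finset.Ioo i N) := by ext; simp; omega
      rw [this, Finset.sum_insert (by simp), add_comm]
    rw [h1, Finset.sum_range_succ, Finset.prod_range_succ, Qq_add hI hn, psiq_add hn, ih]
    ring

theorem tr2_RF [Field K] [CharP K 2] [PerfectRing K 2] {n : ℕ}
    (hn : ∀ x : K, x ^ 2 ^ n = x) (k e : ℕ) (b : ℕ → K) (x : K) :
    tr2 n (x * RF k e b x) = tr2 n (∑ i ∈ Finset.range (e + 1), ∑ l ∈ Finset.Ioo i (e + 1),
      (b i * x ^ (2 ^ k) ^ i) * (b l * x ^ (2 ^ k) ^ l)) := by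
  simp only [RF, aRF, Finset.mul_sum, Finset.sum_mul, tr2_sum]
  rw [Finset.sum_sigma', Finset.sum_sigma']
  refine Finset.sum_bij' (fun p _ => (⟨p.2, p.2 + p.1⟩ : Σ _ : ℕ, ℕ))
    (fun p _ => (⟨p.2 - p.1, p.1⟩ : Σ _ : ℕ, ℕ)) ?_ ?_ ?_ ?_ ?_
  · rintro ⟨i, l⟩ h
    simp only [Finset.mem_sigma, Finset.mem_Icc, Finset.mem_range, Finset.mem_Ioo] at h ⊢
    omega
  · rintro ⟨i, l⟩ h
    simp only [Finset.mem_sigma, Finset.mem_Icc, Finset.mem_range, Finset.mem_Ioo] at h ⊢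
    omega
  · rintro ⟨i, l⟩ h
    simp
  · rintro ⟨i, l⟩ h
    simp only [Finset.mem_sigma, Finset.mem_Icc, Finset.mem_range, Finset.mem_Ioo] at h
    have : i + (l - i) = l := by omega
    simp [this]
  · rintro ⟨i, l⟩ h
    simp only
    rw [← tr2_pow_inv n (k * l) (x * _) (hn _), mul_pow, mul_pow, rt_pow]
    congr 1
    have e1 : (x ^ (2 ^ k) ^ i) ^ 2 ^ (k * l) = x ^ (2 ^ k) ^ (l + i) := by
      rw [← pow_mul]; congr 1; rw [← pow_mul, ← pow_mul, ← pow_add]; congr 1; ring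
    have e2 : x ^ 2 ^ (k * l) = x ^ (2 ^ k) ^ l := by rw [pow_mul 2 k l]
    rw [e1, e2]
    ring

theorem Qq_F [Field K] [CharP K 2] [PerfectRing K 2] {I : ℂ} (hI : I ^ 2 = -1) {n : ℕ}
    (hn : ∀ x : K, x ^ 2 ^ n = x) (k e : ℕ) (b : ℕ → K) (hb2 : adj k e b 1 = 0) (x : K) :
    Qq I n (Lpoly (2 ^ k) e b x) = psiq n (x * RF k e b x + gammaF k e b * x ^ 2) := by
  rw [Lpoly, Qq_sum hI hn, psiq_add hn, psiq_congr (tr2_RF hn k e b x), mul_comm]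
  congr 1
  have h1 : ∀ i, Qq I n (b i * x ^ (2 ^ k) ^ i) = Qq I n (rt K (k * i) (b i) * x) := by
    intro i
    rw [← Qq_pow I hn (k * i) (rt K (k * i) (b i) * x), mul_pow, rt_pow, pow_mul 2 k i]
  simp only [h1]
  have h2 := Qq_sum hI hn (e + 1) (fun i => rt K (k * i) (b i) * x)
  have h3 : ∑ i ∈ Finset.range (e + 1), rt K (k * i) (b i) * x = 0 := by
    rw [← Finset.sum_mul]
    have : ∑ i ∈ Finset.range (e + 1), rt K (k * i) (b i) = adj k e b 1 := by
      simp [adj]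
    rw [this, hb2, zero_mul]
  have h4 : ∑ i ∈ Finset.range (e + 1), ∑ l ∈ Finset.Ioo i (e + 1),
      (rt K (k * i) (b i) * x) * (rt K (k * l) (b l) * x) = gammaF k e b * x ^ 2 := by
    simp only [gammaF, Finset.sum_mul]
    refine Finset.sum_congr rfl fun i _ => Finset.sum_congr rfl fun l _ => ?_
    ring
  simp only [h3, h4, Qq_zero] at h2
  have h5 := psiq_sq n (gammaF k e b * x ^ 2)
  calc _ = (∏ i ∈ Finset.range (e + 1), Qq I n (rt K (k * i) (b i) * x))
        * (psiq n (gammaF k e b * x ^ 2) * psiq n (gammaF k e b * x ^ 2)) := by rw [h5, mul_one]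
    _ = _ := by rw [← mul_assoc, ← h2, one_mul]

/-- The exponential sum. -/
def Gsum [Field K] [Fintype K] (n : ℕ) (R : K → K) : ℂ := ∑ x : K, psiq n (x * R x)

theorem Ncount_eq [Field K] [Fintype K] [CharP K 2] {n k m : ℕ} (hk : 1 ≤ k)
    (hcard : Fintype.card K = 2 ^ n) (hnm : n = m * k) (R : K → K)
    (hR : ∀ d x : K, d ^ 2 ^ k = d → R (d * x) = d * R x) :
    (Ncount K (2 ^ k) R : ℂ) = 2 ^ n + (2 ^ k - 1) * Gsum n R := by
  have hn := pow_card' hcard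
  have hfix := fix_card hcard k m hk hnm
  have hker : ∀ w : K, rt K k w + w = 0 ↔ w ^ 2 ^ k + w = 0 := by
    intro w
    rw [CharTwo.add_eq_zero, CharTwo.add_eq_zero]
    constructor
    · intro h
      have := rt_pow k w
      rw [h] at this; exact this
    · intro h
      apply pow_two_inj k
      rw [rt_pow, h]
  have hadj : ∀ x y : K, tr2 n ((x ^ 2 ^ k + x) * y) = tr2 n (x * (rt K k y + y)) := by
    intro x y
    rw [add_mul, mul_add, tr2_add, tr2_add, ← tr2_pow_inv n k (x * rt K k y) (hn _), mul_pow, rt_pow]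
  have hfib := fun y => fiber_card hcard (fun x : K => x ^ 2 ^ k + x) (fun x => rt K k x + x) hadj y
  have h1 : (Ncount K (2 ^ k) R : ℂ) = ∑ x : K,
      (((Finset.univ.filter fun y : K => y ^ 2 ^ k + y = x * R x).card : ℕ) : ℂ) := by
    rw [Ncount, Nat.card_eq_fintype_card, Fintype.card_subtype, ← Nat.cast_sum]
    congr 1
    simp only [Finset.card_filter]
    rw [← Finset.univ_product_univ, Finset.sum_product]
    simp only [CharTwo.sub_eq_add]
  rw [h1]
  simp only [hfib]
  rw [Finset.sum_comm]
  simp only [hker]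
  have h2 : ∀ v ∈ Finset.univ.filter (fun v : K => v ^ 2 ^ k + v = 0), v ≠ 0 →
      ∑ x : K, psiq n (v * (x * R x)) = Gsum n R := by
    intro v hv hv0
    have hv1 : v ^ 2 ^ k = v := CharTwo.add_eq_zero.mp (Finset.mem_filter.mp hv).2
    set d := rt K 1 v with hd
    have hd2 : d ^ 2 = v := rt_pow 1 v
    have hdk : d ^ 2 ^ k = d := by
      apply pow_two_inj 1
      rw [← pow_mul, mul_comm, pow_mul, pow_one, hd2, hv1]
    have hd0 : d ≠ 0 := by
      intro h; rw [h] at hd2; exact hv0 (by rw [← hd2]; simp)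
    rw [Gsum, ← Equiv.sum_comp (Equiv.mulLeft₀ d hd0) (fun x => psiq n (x * R x))]
    refine Finset.sum_congr rfl fun x _ => ?_
    rw [Equiv.mulLeft₀_apply, hR d x hdk, ← hd2]
    congr 1; ring
  have h0mem : (0 : K) ∈ Finset.univ.filter (fun v : K => v ^ 2 ^ k + v = 0) := by
    simp
  rw [← Finset.add_sum_erase _ _ h0mem]
  congr 1
  · simp [psiq_zero, hcard]
  · rw [Finset.sum_congr rfl (g := fun _ => Gsum n R)
      (fun v hv => h2 v (Finset.mem_of_mem_erase hv) (Finset.ne_of_mem_erase hv))]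
    rw [Finset.sum_const, Finset.card_erase_of_mem h0mem, hfix, nsmul_eq_mul,
      Nat.cast_sub Nat.one_le_two_pow]
    push_cast
    rfl

theorem RF_smul [Field K] [CharP K 2] [PerfectRing K 2] (k e : ℕ) (b : ℕ → K) (a d x : K)
    (hd : d ^ 2 ^ k = d) : RF k e b (d * x) + a * (d * x) = d * (RF k e b x + a * x) := by
  have h : ∀ i, d ^ (2 ^ k) ^ i = d := by
    intro i
    rw [← pow_mul, mul_comm]
    exact pow_iter_fix k i d hd
  simp only [RF, mul_add, Finset.mul_sum, mul_pow, h]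
  congr 1
  · exact Finset.sum_congr rfl fun i _ => by ring
  · ring

/-- The quadratic Gauss sum. -/
theorem tau_eq [Field K] [Fintype K] [CharP K 2] {I : ℂ} (hI : I ^ 2 = -1) {h : ℕ} (hh : 1 ≤ h)
    (hcard : Fintype.card K = 2 ^ (2 * h)) (t : K) (ht : t ^ 2 ^ h + t = 1) :
    ∑ y : K, Qq I (2 * h) y = -I ^ h * 2 ^ h := by
  have hn := pow_card' hcard
  have hQ : Qq I (2 * h) t = -I ^ h := by
    have := Qq_t0 hI h 1 t ht
    rwa [one_mul, pow_one] at this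
  have hQf : ∀ v : K, v ^ 2 ^ h = v → Qq I (2 * h) v = psiq (2 * h) (t * v) := by
    intro v hv
    have := Qq_fixed I h 1 t v ht hv
    rwa [one_mul] at this
  have hadj : ∀ x y : K, tr2 (2 * h) ((x ^ 2 ^ h + x) * y)
      = tr2 (2 * h) (x * (y ^ 2 ^ h + y)) := by
    intro x y
    rw [add_mul, mul_add, tr2_add, tr2_add, ← tr2_pow_inv (2 * h) h (x * y ^ 2 ^ h) (hn _), mul_pow,
      ← pow_mul, ← pow_add, ← two_mul, hn]
  have hs := sum_comp_eq hcard (fun x : K => x ^ 2 ^ h + x) (fun x : K => x ^ 2 ^ h + x) hadj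
    (fun y => Qq I (2 * h) y * psiq (2 * h) (t * y)) (by
      intro y w hw
      have hw' := hQf w (CharTwo.add_eq_zero.mp hw)
      rw [Qq_add hI hn, mul_add, psiq_add hn, hw', mul_comm y w]
      linear_combination (Qq I (2 * h) y * psiq (2 * h) (w * y) * psiq (2 * h) (t * y)) *
        psiq_sq (2 * h) (t * w))
  rw [fix_card hcard h 2 hh rfl] at hs
  have hone : ∀ x : K, Qq I (2 * h) (x ^ 2 ^ h + x) * psiq (2 * h) (t * (x ^ 2 ^ h + x)) = 1 := by
    intro x
    rw [hQf, psiq_sq]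
    rw [add_pow_char_pow, ← pow_mul, ← pow_add, ← two_mul, hn, add_comm]
  simp only [hone] at hs
  have hs2 : (2 : ℂ) ^ h * 2 ^ h
      = 2 ^ h * ∑ y : K, Qq I (2 * h) y * psiq (2 * h) (t * y) := by
    rw [Finset.sum_const, Finset.card_univ, hcard] at hs
    push_cast at hs
    rw [← hs, nsmul_eq_mul, mul_one, two_mul, pow_add]
    push_cast
    rfl
  have hs3 := mul_left_cancel₀ (pow_ne_zero h (two_ne_zero (α := ℂ))) hs2
  rw [hs3, ← hQ, Finset.mul_sum, ← Equiv.sum_comp (Equiv.addRight t)]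
  refine Finset.sum_congr rfl fun y _ => ?_
  rw [Equiv.coe_addRight, Qq_add hI hn, mul_comm y t]
  ring

theorem exists_t0 [Field K] [Fintype K] [CharP K 2] {n : ℕ} (h nu : ℕ) (hh : 1 ≤ h)
    (hcard : Fintype.card K = 2 ^ n) (hn : n = nu * (2 * h)) :
    ∃ t : K, t ^ 2 ^ h + t = 1 := by
  have hlt : 1 < 2 ^ h := Nat.one_lt_two_pow (by omega)
  have hdeg : (Polynomial.X ^ 2 ^ h + Polynomial.X + 1 :
      Polynomial (AlgebraicClosure K)).degree ≠ 0 := by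
    have h1 : (Polynomial.X ^ 2 ^ h + (Polynomial.X + 1) :
      Polynomial (AlgebraicClosure K)).degree = ((2 ^ h : ℕ) : WithBot ℕ) := by
      rw [Polynomial.degree_add_eq_left_of_degree_lt, Polynomial.degree_X_pow]
      rw [Polynomial.degree_X_pow]
      have := Polynomial.degree_X_add_C (1 : AlgebraicClosure K)
      rw [Polynomial.C_1] at this
      rw [this]
      exact_mod_cast hlt
    rw [add_assoc, h1]
    have : 2 ^ h ≠ 0 := by positivity
    exact_mod_cast this
  obtain ⟨x, hx⟩ := IsAlgClosed.exists_root _ hdeg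
  have hx' : x ^ 2 ^ h = x + 1 := by
    simp [Polynomial.IsRoot] at hx
    rw [add_assoc] at hx
    exact CharTwo.add_eq_zero.mp hx
  have hxx : x ^ 2 ^ (2 * h) = x := by
    rw [two_mul, pow_add, pow_mul, hx', add_pow_char_pow, hx', one_pow, add_assoc,
      CharTwo.add_self_eq_zero, add_zero]
  obtain ⟨t, rfl⟩ := mem_range_of_pow hcard x (by rw [hn]; exact pow_iter_fix _ _ _ hxx)
  refine ⟨t, ?_⟩
  apply (algebraMap K (AlgebraicClosure K)).injective
  rw [map_add, map_pow, hx', map_one]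
  linear_combination CharTwo.add_self_eq_zero (algebraMap K (AlgebraicClosure K) t)

theorem Lpoly_surj {L : Type*} [Field L] [IsAlgClosed L] (k e : ℕ) (hk : 1 ≤ k) (c : ℕ → L)
    (hc : c 0 ≠ 0) (w : L) : ∃ x, Lpoly (2 ^ k) e c x = w := by
  have hk2 : 1 < 2 ^ k := Nat.one_lt_two_pow (by omega)
  set P : Polynomial L := ∑ i ∈ Finset.range (e + 1),
    Polynomial.C (c i) * Polynomial.X ^ (2 ^ k) ^ i with hP
  have hco : (P - Polynomial.C w).coeff 1 = c 0 := by
    rw [Polynomial.coeff_sub, Polynomial.coeff_C_ne_zero one_ne_zero, sub_zero, hP,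
      Polynomial.finsetSum_coeff, Finset.sum_eq_single 0]
    · simp
    · intro i _ hi
      have : 1 < (2 ^ k) ^ i := Nat.one_lt_pow hi hk2
      rw [Polynomial.coeff_C_mul, Polynomial.coeff_X_pow, if_neg (by omega), mul_zero]
    · simp
  have hd : (P - Polynomial.C w).degree ≠ 0 := by
    have h1 := Polynomial.le_degree_of_ne_zero (p := P - Polynomial.C w) (n := 1)
      (by rw [hco]; exact hc)
    intro h0
    rw [h0] at h1
    exact absurd h1 (by decide)
  obtain ⟨x, hx⟩ := IsAlgClosed.exists_root _ hd
  refine ⟨x, ?_⟩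
  rw [Polynomial.IsRoot, Polynomial.eval_sub, Polynomial.eval_C, sub_eq_zero] at hx
  rw [← hx]
  simp [hP, Lpoly, Polynomial.eval_finsetSum]

theorem Gsum_terms [Field K] [Fintype K] [CharP K 2] {I : ℂ} (hI : I ^ 2 = -1) {n : ℕ}
    (hn : ∀ x : K, x ^ 2 ^ n = x) (k e : ℕ) (b : ℕ → K) (hb2 : adj k e b 1 = 0) (a s x : K)
    (hs : s ^ 2 = a + gammaF k e b) :
    psiq n (x * (RF k e b x + a * x)) = Qq I n (Lpoly (2 ^ k) e b x) * psiq n (s * x) := by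
  rw [Qq_F hI hn k e b hb2]
  have h1 : psiq n (s * x) = psiq n ((s * x) ^ 2 ^ 1) :=
    psiq_congr (tr2_pow_inv n 1 (s * x) (hn _)).symm
  rw [h1, ← psiq_add hn, pow_one, mul_pow, hs]
  congr 1
  linear_combination -(x ^ 2) * CharTwo.add_self_eq_zero (gammaF k e b)

theorem Gsum_zero_of_notMem [Field K] [Fintype K] [CharP K 2] {I : ℂ} (hI : I ^ 2 = -1) {n : ℕ}
    (hcard : Fintype.card K = 2 ^ n) (k e : ℕ) (b : ℕ → K) (hb2 : adj k e b 1 = 0) (a s : K)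
    (hs : s ^ 2 = a + gammaF k e b) (hns : ¬ ∃ t, adj k e b t = s) :
    Gsum n (fun x => RF k e b x + a * x) = 0 := by
  have hn := pow_card' hcard
  have hadj : ∀ x y : K, tr2 n (adj k e b x * y) = tr2 n (x * Lpoly (2 ^ k) e b y) := by
    intro x y
    rw [mul_comm, ← adj_hadj hn k e b y x, mul_comm]
  have hF0 : Lpoly (2 ^ k) e b 0 = 0 := by
    have := Lpoly_add k e b 0 0
    rw [add_zero] at this
    exact left_eq_add.mp this
  have h1 : ¬ ∀ w, Lpoly (2 ^ k) e b w = 0 → psiq n (w * s) = 1 := by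
    intro h
    exact hns (mem_range_of_perp hcard _ _ hadj hF0 s h)
  push Not at h1
  obtain ⟨w, hw, hw1⟩ := h1
  have hw2 : psiq n (s * w) = -1 := by
    rw [mul_comm]
    exact (psiq_cases n (w * s)).resolve_left hw1
  simp only [Gsum, Gsum_terms hI hn k e b hb2 a s _ hs]
  have h2 := Equiv.sum_comp (Equiv.addRight w)
    (fun x => Qq I n (Lpoly (2 ^ k) e b x) * psiq n (s * x))
  simp only [Equiv.coe_addRight, Lpoly_add, hw, add_zero, mul_add, psiq_add hn, hw2] at h2
  simp only [mul_neg, mul_one, Finset.sum_neg_distrib] at h2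
  have h3 : (2 : ℂ) * ∑ x : K, Qq I n (Lpoly (2 ^ k) e b x) * psiq n (s * x) = 0 := by
    linear_combination -h2
  simpa using h3

theorem Gsum_adj [Field K] [Fintype K] [CharP K 2] {I : ℂ} (hI : I ^ 2 = -1) {n : ℕ}
    (hcard : Fintype.card K = 2 ^ n) (k e : ℕ) (b : ℕ → K) (hb2 : adj k e b 1 = 0) (a t : K)
    (hs : adj k e b t ^ 2 = a + gammaF k e b) :
    Gsum n (fun x => RF k e b x + a * x)
      = ∑ x, Qq I n (Lpoly (2 ^ k) e b x) * psiq n (t * Lpoly (2 ^ k) e b x) := by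
  have hn := pow_card' hcard
  rw [Gsum]
  refine Finset.sum_congr rfl fun x _ => ?_
  rw [Gsum_terms hI hn k e b hb2 a _ x hs]
  congr 1
  apply psiq_congr
  rw [mul_comm, ← adj_hadj hn, mul_comm]

theorem Gsum_zero_of_notSF [Field K] [Fintype K] [CharP K 2] {I : ℂ} (hI : I ^ 2 = -1) {n : ℕ}
    (hcard : Fintype.card K = 2 ^ n) (k e : ℕ) (b : ℕ → K) (hb2 : adj k e b 1 = 0) (a t : K)
    (hs : adj k e b t ^ 2 = a + gammaF k e b)
    (hWF : ∀ w, adj k e b w = 0 → ∃ x, Lpoly (2 ^ k) e b x = w)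
    (ht : ¬ ∀ v, adj k e b v = 0 → Qq I n v = psiq n (t * v)) :
    Gsum n (fun x => RF k e b x + a * x) = 0 := by
  have hn := pow_card' hcard
  push Not at ht
  obtain ⟨w, hw, hw1⟩ := ht
  obtain ⟨x0, hx0⟩ := hWF w hw
  rw [Gsum_adj hI hcard k e b hb2 a t hs]
  have h2 := Equiv.sum_comp (Equiv.addRight x0)
    (fun x => Qq I n (Lpoly (2 ^ k) e b x) * psiq n (t * Lpoly (2 ^ k) e b x))
  have h3 : ∀ x, psiq n (Lpoly (2 ^ k) e b x * w) = 1 := by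
    intro x
    rw [psiq_congr (adj_hadj hn k e b x w), hw, mul_zero, psiq_zero]
  simp only [Equiv.coe_addRight, Lpoly_add, hx0, mul_add, psiq_add hn, Qq_add hI hn, h3,
    mul_one] at h2
  have h4 : ∑ x, Qq I n (Lpoly (2 ^ k) e b x) * Qq I n w *
      (psiq n (t * Lpoly (2 ^ k) e b x) * psiq n (t * w)) = (Qq I n w * psiq n (t * w)) *
      ∑ x, Qq I n (Lpoly (2 ^ k) e b x) * psiq n (t * Lpoly (2 ^ k) e b x) := by
    rw [Finset.mul_sum]
    exact Finset.sum_congr rfl fun x _ => by ring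
  rw [h4] at h2
  have h5 : Qq I n w * psiq n (t * w) ≠ 1 := by
    intro h
    apply hw1
    linear_combination psiq n (t * w) * h - Qq I n w * psiq_sq n (t * w)
  by_contra hne
  exact h5 (mul_right_cancel₀ hne (by rw [h2, one_mul]))

theorem Gsum_SF [Field K] [Fintype K] [CharP K 2] {I : ℂ} (hI : I ^ 2 = -1) {n : ℕ}
    (hcard : Fintype.card K = 2 ^ n) (k e : ℕ) (b : ℕ → K) (hb2 : adj k e b 1 = 0) (a t : K)
    (hs : adj k e b t ^ 2 = a + gammaF k e b)
    (hker : (Finset.univ.filter fun x : K => Lpoly (2 ^ k) e b x = 0).card = (2 ^ k) ^ e)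
    (ht : ∀ v, adj k e b v = 0 → Qq I n v = psiq n (t * v)) :
    Gsum n (fun x => RF k e b x + a * x) * Qq I n t = (2 ^ k) ^ e * ∑ y : K, Qq I n y := by
  have hn := pow_card' hcard
  rw [Gsum_adj hI hcard k e b hb2 a t hs]
  have h1 := sum_comp_eq hcard _ _ (adj_hadj hn k e b)
    (fun y => Qq I n y * psiq n (t * y)) (by
      intro y w hw
      rw [Qq_add hI hn, mul_add, psiq_add hn, ht w hw, mul_comm y w]
      linear_combination (Qq I n y * psiq n (w * y) * psiq n (t * y)) * psiq_sq n (t * w))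
  rw [h1, hker]
  push_cast
  rw [mul_assoc]
  congr 1
  rw [Finset.sum_mul, ← Equiv.sum_comp (Equiv.addRight t) (fun y => Qq I n y)]
  refine Finset.sum_congr rfl fun y _ => ?_
  rw [Equiv.coe_addRight, Qq_add hI hn, mul_comm y t]
  ring

end Helpers

/-- Explicit description of `S_F` and `T_{R,max}` when
`q = q₁^{2ν}` and `W_F^* ⊆ 𝔽_{q₁}`. -/
theorem statement11 {K : Type*} [Field K] [Fintype K] [CharP K 2]
    (k j nu m e : ℕ) (hk : 1 ≤ k) (hj : 1 ≤ j) (hnu : 1 ≤ nu) (he : 1 ≤ e)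
    (hm : m = j * (2 * nu))
    (hcard : Fintype.card K = 2 ^ (k * m))
    (b : ℕ → K)
    (hb1 : b 0 * b e ≠ 0)
    (hb2 : adjBar k e b 1 = 0)
    (hb3 : ∀ x : AlgebraicClosure K, adjBar k e b x = 0 →
      x ∈ Set.range (algebraMap K (AlgebraicClosure K)))
    (hb4 : ∀ x : AlgebraicClosure K, adjBar k e b (LpolyBar k e b x) = 0 →
      x ∈ Set.range (algebraMap K (AlgebraicClosure K)))
    (hsub : ∀ v : K, adjBar k e b (algebraMap K (AlgebraicClosure K) v) = 0 →
      v ^ 2 ^ (k * j) = v)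
    (I : ℂ) (hI : I ^ 2 = -1) :
    (∃ t0 : K, t0 ^ 2 ^ (k * j) + t0 = 1 ∧ t0 ^ (2 ^ (k * j)) ^ 2 = t0) ∧
    ∀ t0 : K, t0 ^ 2 ^ (k * j) + t0 = 1 →
      SF K I k m e b = Set.range (fun u : K => t0 + Lpoly (2 ^ k) e b u) ∧
      TRmax K k m e b ∪ TRmin K k m e b
        = Set.range (fun u : K => alphaF k e b t0 + adj k e b (Lpoly (2 ^ k) e b u) ^ 2) ∧
      TRmax K k m e b
        = (fun u : K => alphaF k e b t0 + adj k e b (Lpoly (2 ^ k) e b u) ^ 2) ''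
            {u : K | tr2 (k * m) (u * RFt k e b t0 u) = ((nu + 1 : ℕ) : K)} := by
  have hn := pow_card' hcard
  have hkj : 1 ≤ k * j := Nat.mul_pos hk hj
  have hnh : k * m = nu * (2 * (k * j)) := by rw [hm]; ring
  have hnh2 : k * m = 2 * (k * j * nu) := by rw [hm]; ring
  have hdiv : k * m / 2 = k * j * nu := by omega
  have hI0 : I ≠ 0 := by rintro rfl; norm_num at hI
  have hW : ∀ v : K, adjBar k e b (algebraMap K (AlgebraicClosure K) v) = 0 ↔
      adj k e b v = 0 := by
    intro v
    rw [adjBar_map]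
    exact map_eq_zero _
  have hb2' : adj k e b 1 = 0 := by
    rw [← hW, map_one, hb2]
  have hker := Lpoly_card k e hk b hb1 (by
    intro x hx
    apply hb4
    have : LpolyBar k e b x = 0 := hx
    rw [this]
    exact adj_zero k e _)
  have hWF : ∀ w, adj k e b w = 0 → ∃ x, Lpoly (2 ^ k) e b x = w := by
    intro w hw
    have hmap : ∀ x, LpolyBar k e b (algebraMap K (AlgebraicClosure K) x)
        = algebraMap K (AlgebraicClosure K) (Lpoly (2 ^ k) e b x) := by
      intro x
      simp [LpolyBar, Lpoly]
    obtain ⟨x, hx⟩ := Lpoly_surj k e hk (fun i => algebraMap K (AlgebraicClosure K) (b i))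
      (by simpa using left_ne_zero_of_mul hb1) (algebraMap K (AlgebraicClosure K) w)
    have hx' : LpolyBar k e b x = algebraMap K (AlgebraicClosure K) w := hx
    obtain ⟨y, rfl⟩ := hb4 x (by rw [hx', hW, hw])
    rw [hmap] at hx'
    exact ⟨y, (algebraMap K (AlgebraicClosure K)).injective hx'⟩
  refine ⟨?_, ?_⟩
  · obtain ⟨t, ht⟩ := exists_t0 (K := K) (k * j) nu hkj hcard hnh
    refine ⟨t, ht, ?_⟩
    have ht' : t ^ 2 ^ (k * j) = t + 1 := by
      linear_combination ht - CharTwo.add_self_eq_zero t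
    rw [sq, pow_mul, ht', add_pow_char_pow, ht', one_pow, add_assoc,
      CharTwo.add_self_eq_zero, add_zero]
  intro t0 ht0
  have hQt0 : Qq I (k * m) t0 = (-I ^ (k * j)) ^ nu := by
    rw [hnh]; exact Qq_t0 hI _ _ _ ht0
  have ht0S : ∀ v, adj k e b v = 0 → Qq I (k * m) v = psiq (k * m) (t0 * v) := by
    intro v hv
    rw [hnh]
    exact Qq_fixed I _ _ _ _ ht0 (hsub v ((hW v).mpr hv))
  have htau : ∑ y : K, Qq I (k * m) y = -I ^ (k * j * nu) * 2 ^ (k * j * nu) := by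
    obtain ⟨t1, ht1⟩ := exists_t0 (K := K) (k * j * nu) 1 (Nat.mul_pos hkj hnu) hcard
      (by rw [one_mul, hnh2])
    have hc2 := hcard
    rw [hnh2] at hc2
    rw [hnh2]
    exact tau_eq hI (Nat.mul_pos hkj hnu) hc2 t1 ht1
  -- description of `S_F`
  have hS : ∀ t : K, (∀ v, adj k e b v = 0 → Qq I (k * m) v = psiq (k * m) (t * v)) ↔
      ∃ u, t0 + Lpoly (2 ^ k) e b u = t := by
    intro t
    constructor
    · intro h
      obtain ⟨u, hu⟩ := mem_range_of_perp hcard _ _ (adj_hadj hn k e b) (adj_zero k e b) (t0 + t)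
        (by
          intro w hw
          rw [mul_add, psiq_add hn, mul_comm w, mul_comm w, ← ht0S w hw, ← h w hw, h w hw, psiq_sq])
      refine ⟨u, ?_⟩
      rw [hu]
      linear_combination CharTwo.add_self_eq_zero t0
    · rintro ⟨u, rfl⟩ v hv
      rw [add_mul, psiq_add hn, ← ht0S v hv, psiq_congr (adj_hadj hn k e b u v), hv, mul_zero,
        psiq_zero, mul_one]
  have hα : ∀ u : K, adj k e b (t0 + Lpoly (2 ^ k) e b u) ^ 2
      = (alphaF k e b t0 + adj k e b (Lpoly (2 ^ k) e b u) ^ 2) + gammaF k e b := by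
    intro u
    rw [adj_add, add_pow_char, alphaF]
    linear_combination -CharTwo.add_self_eq_zero (gammaF k e b)
  set p' : ℂ := (2 ^ k) ^ e * 2 ^ (k * j * nu) with hp'
  have hp0 : p' ≠ 0 := by rw [hp']; exact mul_ne_zero (pow_ne_zero _ (pow_ne_zero _ two_ne_zero)) (pow_ne_zero _ two_ne_zero)
  have hk1 : (2 : ℂ) ^ k - 1 ≠ 0 := by
    intro h
    have h1 : (2 : ℂ) ^ k = 1 := by linear_combination h
    have h2 : 2 ^ k = 1 := by exact_mod_cast h1
    have : 1 < 2 ^ k := Nat.one_lt_two_pow (by omega)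
    omega
  -- values of the exponential sum
  have hG : ∀ u : K, Gsum (k * m) (fun x => RF k e b x +
      (alphaF k e b t0 + adj k e b (Lpoly (2 ^ k) e b u) ^ 2) * x)
      = (-1) ^ (nu + 1) * psiq (k * m) (u * RFt k e b t0 u) * p' := by
    intro u
    have h1 := Gsum_SF hI hcard k e b hb2' _ _ (hα u) hker ((hS _).mpr ⟨u, rfl⟩)
    have h2 : Qq I (k * m) (t0 + Lpoly (2 ^ k) e b u)
        = (-1) ^ nu * I ^ (k * j * nu) * psiq (k * m) (u * RFt k e b t0 u) := by
      have h3 : psiq (k * m) (u * RFt k e b t0 u)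
          = Qq I (k * m) (Lpoly (2 ^ k) e b u) * psiq (k * m) (t0 * Lpoly (2 ^ k) e b u) := by
        rw [RFt, Gsum_terms hI hn k e b hb2' (alphaF k e b t0) (adj k e b t0) u
          (by rw [alphaF]; linear_combination -CharTwo.add_self_eq_zero (gammaF k e b))]
        congr 1
        apply psiq_congr
        rw [mul_comm _ u, ← adj_hadj hn, mul_comm t0]
      rw [Qq_add hI hn, hQt0, h3, neg_pow, ← pow_mul]
      ring
    rw [h2, htau] at h1
    have h4 := psiq_sq (k * m) (u * RFt k e b t0 u)
    have h5 : ((-1 : ℂ) ^ nu) * (-1) ^ nu = 1 := by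
      rw [← mul_pow]; norm_num
    have h6 : I ^ (k * j * nu) ≠ 0 := pow_ne_zero _ hI0
    apply mul_right_cancel₀ h6
    generalize psiq (k * m) (u * RFt k e b t0 u) = ψ at h1 h4 ⊢
    generalize Gsum (k * m) (fun x => RF k e b x +
      (alphaF k e b t0 + adj k e b (Lpoly (2 ^ k) e b u) ^ 2) * x) = G at h1 ⊢
    rw [hp', pow_succ]
    linear_combination (-1 : ℂ) ^ nu * ψ * h1 - G * I ^ (k * j * nu) * h4 * ((-1) ^ nu) * (-1) ^ nu
      - G * I ^ (k * j * nu) * h5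
  have hN : ∀ a : K, (Ncount K (2 ^ k) (fun x => RF k e b x + a * x) : ℂ)
      = 2 ^ (k * m) + (2 ^ k - 1) * Gsum (k * m) (fun x => RF k e b x + a * x) := by
    intro a
    exact Ncount_eq hk hcard (mul_comm k m) _ (fun d x hd => RF_smul k e b a d x hd)
  have hmax : ∀ a : K, a ∈ TRmax K k m e b ↔
      Gsum (k * m) (fun x => RF k e b x + a * x) = p' := by
    intro a
    rw [TRmax, Set.mem_setOf_eq, hdiv, ← Int.cast_inj (α := ℂ)]
    push_cast
    rw [hN]
    constructor
    · intro h
      apply mul_left_cancel₀ hk1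
      rw [hp']
      linear_combination h
    · intro h
      rw [h, hp']
      ring
  have hmin : ∀ a : K, a ∈ TRmin K k m e b ↔
      Gsum (k * m) (fun x => RF k e b x + a * x) = -p' := by
    intro a
    rw [TRmin, Set.mem_setOf_eq, hdiv, ← Int.cast_inj (α := ℂ)]
    push_cast
    rw [hN]
    constructor
    · intro h
      apply mul_left_cancel₀ hk1
      rw [hp']
      linear_combination h
    · intro h
      rw [h, hp']
      ring
  have hrange : ∀ a : K, Gsum (k * m) (fun x => RF k e b x + a * x) ≠ 0 →
      ∃ u, alphaF k e b t0 + adj k e b (Lpoly (2 ^ k) e b u) ^ 2 = a := by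
    intro a ha
    have hs : (rt K 1 (a + gammaF k e b)) ^ 2 = a + gammaF k e b := rt_pow 1 _
    by_cases h1 : ∃ t, adj k e b t = rt K 1 (a + gammaF k e b)
    · obtain ⟨t, ht⟩ := h1
      rw [← ht] at hs
      by_cases h2 : ∀ v, adj k e b v = 0 → Qq I (k * m) v = psiq (k * m) (t * v)
      · obtain ⟨u, rfl⟩ := (hS t).mp h2
        refine ⟨u, ?_⟩
        have := (hα u).symm.trans hs
        exact add_right_cancel this
      · exact absurd (Gsum_zero_of_notSF hI hcard k e b hb2' a t hs hWF h2) ha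
    · exact absurd (Gsum_zero_of_notMem hI hcard k e b hb2' a _ hs h1) ha
  have hpm : ∀ u : K, (-1 : ℂ) ^ (nu + 1) * psiq (k * m) (u * RFt k e b t0 u) = 1 ∨
      (-1 : ℂ) ^ (nu + 1) * psiq (k * m) (u * RFt k e b t0 u) = -1 := by
    intro u
    rcases psiq_cases (k * m) (u * RFt k e b t0 u) with h | h <;>
    rcases neg_one_pow_eq_or ℂ (nu + 1) with h' | h' <;> simp [h, h']
  have hcond : ∀ u : K, (-1 : ℂ) ^ (nu + 1) * psiq (k * m) (u * RFt k e b t0 u) = 1 ↔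
      tr2 (k * m) (u * RFt k e b t0 u) = ((nu + 1 : ℕ) : K) := by
    intro u
    have hc := tr2_cases (k * m) (u * RFt k e b t0 u) (hn _)
    have hneg : ¬ ((-1 : ℂ) = 1) := by norm_num
    rcases Nat.even_or_odd (nu + 1) with h | h
    · have hz : ((nu + 1 : ℕ) : K) = 0 := by
        rw [CharP.cast_eq_zero_iff K 2]; exact h.two_dvd
      rw [h.neg_one_pow, hz, psiq]
      rcases hc with hc | hc <;> simp [hc, hneg]
    · have hz : ((nu + 1 : ℕ) : K) = 1 := by
        obtain ⟨c, hc⟩ := h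
        rw [hc]; push_cast; rw [CharTwo.two_eq_zero]; ring
      rw [h.neg_one_pow, hz, psiq]
      rcases hc with hc | hc <;> simp [hc, hneg]
  refine ⟨?_, ?_, ?_⟩
  · ext t
    rw [SF, Set.mem_setOf_eq, Set.mem_range]
    simp only [hW]
    exact hS t
  · ext a
    rw [Set.mem_union, hmax, hmin, Set.mem_range]
    constructor
    · intro h
      apply hrange
      rcases h with h | h <;> rw [h]
      · exact hp0
      · exact neg_ne_zero.mpr hp0
    · rintro ⟨u, rfl⟩
      simp only [hG]
      rcases hpm u with h | h <;> rw [h] <;> simp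
  · ext a
    rw [hmax, Set.mem_image]
    constructor
    · intro h
      obtain ⟨u, rfl⟩ := hrange a (by rw [h]; exact hp0)
      refine ⟨u, ?_, rfl⟩
      rw [hG] at h
      rw [Set.mem_setOf_eq, ← hcond]
      exact mul_right_cancel₀ hp0 (by rw [h, one_mul])
    · rintro ⟨u, hu, rfl⟩
      rw [Set.mem_setOf_eq, ← hcond] at hu
      rw [hG, hu, one_mul]

end
end

section
/- Suppose q = r² where r is a power of p. Assume F satisfies conditions (i)–(iv) and that W_F* is contained in the subfield F_r ⊆ F_q. Let t_0 ∈ F_q satisfy t_0^r + t_0 = 1. Then the curve y^p − y = x·R_{F,t_0}(x) is F_q-maximal; that is, |{(x,y) ∈ F_q × F_q : y^p − y = x·R_{F,t_0}(x)}| = q + (p−1)·p^e·r. -/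
open Finset

open scoped Classical

noncomputable section

variable {K : Type*}

set_option linter.unusedSectionVars false

namespace Aux

/-- Second elementary symmetric sum of `f 0, …, f (n-1)`. -/
def E2 {R : Type*} [CommRing R] (n : ℕ) (f : ℕ → R) : R :=
  ∑ b ∈ range n, (∑ a ∈ range b, f a) * f b

section ring
variable {R : Type*} [CommRing R]

lemma E2_zero (f : ℕ → R) : E2 0 f = 0 := by simp [E2]

lemma E2_succ (n : ℕ) (f : ℕ → R) : E2 (n + 1) f = E2 n f + (∑ a ∈ range n, f a) * f n := by
  simp [E2, sum_range_succ]

lemma E2_add (n : ℕ) (f g : ℕ → R) : E2 n (fun i => f i + g i) = E2 n f + E2 n g +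
    (∑ i ∈ range n, f i) * (∑ i ∈ range n, g i) - ∑ i ∈ range n, f i * g i := by
  induction n with
  | zero => simp [E2_zero]
  | succ n ih => simp only [E2_succ, ih, sum_range_succ, sum_add_distrib]; ring

lemma E2_shift_aux (n : ℕ) (f : ℕ → R) :
    E2 (n + 1) f = E2 n (fun i => f (i + 1)) + f 0 * ∑ i ∈ range n, f (i + 1) := by
  induction n with
  | zero => simp [E2_zero, E2_succ]
  | succ n ih =>
    rw [E2_succ, ih, E2_succ n, sum_range_succ' f n, sum_range_succ _ n]; ring

lemma E2_shift (n : ℕ) (f : ℕ → R) (h : f n = f 0) : E2 n (fun i => f (i + 1)) = E2 n f := by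
  have h1 := E2_shift_aux n f
  rw [E2_succ] at h1
  have h2 : ∑ i ∈ range n, f (i + 1) = ∑ i ∈ range n, f i := by
    have h3 := sum_range_succ f n
    rw [sum_range_succ' f n, h] at h3
    exact add_right_cancel h3
  rw [h2, h] at h1
  linear_combination -h1

lemma E2_split (h h' : ℕ) (f : ℕ → R) : E2 (h + h') f = E2 h f + E2 h' (fun i => f (h + i)) +
    (∑ i ∈ range h, f i) * ∑ i ∈ range h', f (h + i) := by
  induction h' with
  | zero => simp [E2_zero]
  | succ n ih =>
    rw [← add_assoc, E2_succ, ih, E2_succ n, sum_range_add, sum_range_succ]; ring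

lemma E2_double [CharP R 2] (h : ℕ) (f : ℕ → R) (hf : ∀ i, f (h + i) = f i) :
    E2 (h + h) f = (∑ i ∈ range h, f i) ^ 2 := by
  rw [E2_split]
  simp only [hf]
  rw [show E2 h (fun i => f i) = E2 h f from rfl, CharTwo.add_self_eq_zero]; ring

end ring

section field
variable {K : Type*} [Field K] [CharP K 2]

lemma add_pow2 (x y : K) (i : ℕ) : (x + y) ^ 2 ^ i = x ^ 2 ^ i + y ^ 2 ^ i := by
  have : Fact (Nat.Prime 2) := ⟨Nat.prime_two⟩
  exact add_pow_char_pow x y 2 i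

lemma sum_pow2 {ι : Type*} (s : Finset ι) (f : ι → K) (i : ℕ) :
    (∑ x ∈ s, f x) ^ 2 ^ i = ∑ x ∈ s, f x ^ 2 ^ i := by
  induction s using Finset.induction_on with
  | empty => simp
  | insert a s ha ih => rw [sum_insert ha, sum_insert ha, add_pow2, ih]

lemma pow2_inj (i : ℕ) {x y : K} (h : x ^ 2 ^ i = y ^ 2 ^ i) : x = y := by
  have : (x + y) ^ 2 ^ i = 0 := by rw [add_pow2, h, CharTwo.add_self_eq_zero]
  have := eq_zero_of_pow_eq_zero this
  exact CharTwo.add_eq_zero.mp this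

lemma tr2_add (n : ℕ) (x y : K) : tr2 n (x + y) = tr2 n x + tr2 n y := by
  simp [tr2, add_pow2, sum_add_distrib]

lemma tr2_zero (n : ℕ) : tr2 n (0 : K) = 0 := by
  simp [tr2]

lemma tr2_sum {ι : Type*} (n : ℕ) (s : Finset ι) (f : ι → K) :
    tr2 n (∑ x ∈ s, f x) = ∑ x ∈ s, tr2 n (f x) := by
  induction s using Finset.induction_on with
  | empty => simp [tr2_zero]
  | insert a s ha ih => rw [sum_insert ha, sum_insert ha, tr2_add, ih]

/-- e2 of the conjugates -/
def ss (n : ℕ) (x : K) : K := E2 n (fun i => x ^ 2 ^ i)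

lemma ss_add (n : ℕ) (x y : K) :
    ss n (x + y) = ss n x + ss n y + tr2 n x * tr2 n y - tr2 n (x * y) := by
  simp only [ss, add_pow2, E2_add, tr2, mul_pow]

lemma ss_zero (n : ℕ) : ss n (0 : K) = 0 := by
  simp [ss, E2]

lemma ss_sum (n N : ℕ) (u : ℕ → K) :
    ss n (∑ i ∈ range N, u i) = ∑ i ∈ range N, ss n (u i) + E2 N (fun i => tr2 n (u i))
      - tr2 n (E2 N u) := by
  induction N with
  | zero => simp [ss_zero, E2_zero, tr2_zero]
  | succ N ih =>
    rw [sum_range_succ, ss_add, ih, E2_succ, E2_succ, tr2_add, tr2_sum, sum_range_succ]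
    ring

lemma tr2_sq {n : ℕ} (hn : ∀ x : K, x ^ 2 ^ n = x) (x : K) : tr2 n (x ^ 2) = tr2 n x := by
  have h1 := sum_range_succ (fun i => x ^ 2 ^ i) n
  rw [sum_range_succ'] at h1
  simp only [hn, pow_zero, pow_one] at h1
  have h2 := add_right_cancel h1
  rw [tr2, tr2, ← h2]
  refine sum_congr rfl fun i _ => ?_
  rw [← pow_mul, pow_succ' 2 i]

lemma tr2_sq' (n : ℕ) (x : K) : tr2 n x ^ 2 = tr2 n (x ^ 2) := by
  have := sum_pow2 (range n) (fun i => x ^ 2 ^ i) 1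
  rw [pow_one] at this
  rw [tr2, this, tr2]
  refine sum_congr rfl fun i _ => ?_
  rw [← pow_mul, ← pow_mul, mul_comm]

lemma tr2_pow {n : ℕ} (hn : ∀ x : K, x ^ 2 ^ n = x) (i : ℕ) (x : K) :
    tr2 n (x ^ 2 ^ i) = tr2 n x := by
  induction i with
  | zero => simp
  | succ i ih => rw [pow_succ, pow_mul, tr2_sq hn, ih]

lemma ss_sq {n : ℕ} (hn : ∀ x : K, x ^ 2 ^ n = x) (x : K) : ss n (x ^ 2) = ss n x := by
  have := E2_shift n (fun i => x ^ 2 ^ i) (by simp [hn])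
  rw [ss, ss, ← this]
  congr 1
  funext i
  rw [← pow_mul, pow_succ' 2 i]

lemma ss_pow {n : ℕ} (hn : ∀ x : K, x ^ 2 ^ n = x) (i : ℕ) (x : K) :
    ss n (x ^ 2 ^ i) = ss n x := by
  induction i with
  | zero => simp
  | succ i ih => rw [pow_succ, pow_mul, ss_sq hn, ih]

lemma tr2_zero_or_one {n : ℕ} (hn : ∀ x : K, x ^ 2 ^ n = x) (x : K) :
    tr2 n x = 0 ∨ tr2 n x = 1 := by
  have h := tr2_sq' n x
  rw [tr2_sq hn] at h
  have : tr2 n x * (tr2 n x - 1) = 0 := by linear_combination h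
  rcases mul_eq_zero.mp this with h | h
  · exact Or.inl h
  · exact Or.inr (sub_eq_zero.mp h)

/-- trace from `F_q` in terms of trace from `F_r`, `q = r^2`. -/
lemma tr2_double (h : ℕ) (x : K) : tr2 (h + h) x = tr2 h (x + x ^ 2 ^ h) := by
  rw [tr2_add, tr2, sum_range_add, tr2, tr2]
  congr 1
  refine sum_congr rfl fun i _ => ?_
  rw [← pow_mul, pow_add]

lemma tr2_double_sub (h : ℕ) (x : K) (hx : x ^ 2 ^ h = x) : tr2 (h + h) x = 0 := by
  rw [tr2_double, hx, CharTwo.add_self_eq_zero, tr2_zero]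

lemma ss_double_sub (h : ℕ) (x : K) (hx : x ^ 2 ^ h = x) : ss (h + h) x = tr2 h x := by
  rw [ss, E2_double]
  · change tr2 h x ^ 2 = tr2 h x
    have := tr2_sq' h x
    rw [this]
    have h1 := sum_range_succ (fun i => x ^ 2 ^ i) h
    rw [sum_range_succ'] at h1
    simp only [hx, pow_zero, pow_one] at h1
    have h2 := add_right_cancel h1
    rw [tr2, tr2, ← h2]
    refine sum_congr rfl fun i _ => ?_
    rw [← pow_mul, pow_succ' 2 i]
  · intro i
    rw [pow_add, pow_mul, hx]

lemma tr2_t (h : ℕ) (x t : K) (hx : x ^ 2 ^ h = x) (ht : t ^ 2 ^ h + t = 1) :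
    tr2 (h + h) (t * x) = tr2 h x := by
  rw [tr2_double, mul_pow, hx, ← add_mul, add_comm t, ht, one_mul]

lemma rt_pow [PerfectRing K 2] (i : ℕ) (x : K) : rt K i x ^ 2 ^ i = x :=
  iterate_frobeniusEquiv_symm_pow_p_pow K 2 x i

/-- character -/
def chi (n : ℕ) (x : K) : ℤ := if tr2 n x = 0 then 1 else -1

lemma chi_of_tr {n : ℕ} {x y : K} (h : tr2 n x = tr2 n y) : chi n x = chi n y := by
  simp [chi, h]

lemma chi_add {n : ℕ} (hn : ∀ x : K, x ^ 2 ^ n = x) (x y : K) :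
    chi n (x + y) = chi n x * chi n y := by
  have h2 : (1 : K) + 1 = 0 := CharTwo.add_self_eq_zero 1
  rcases tr2_zero_or_one hn x with h | h <;> rcases tr2_zero_or_one hn y with h' | h' <;>
    simp [chi, tr2_add, h, h', h2]

lemma chi_zero (n : ℕ) : chi n (0 : K) = 1 := by simp [chi, tr2_zero]

lemma sum_zero (A : Finset K) (g : K → ℤ) (a : K) (hA : ∀ x ∈ A, x + a ∈ A)
    (hg : ∀ x ∈ A, g (x + a) = - g x) : ∑ x ∈ A, g x = 0 := by
  refine Finset.sum_involution (fun x _ => x + a) ?_ ?_ ?_ ?_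
  · intro x hx; simp [hg x hx]
  · intro x hx h0 h1
    have := hg x hx
    rw [h1] at this
    omega
  · intro x hx; exact hA x hx
  · intro x hx; simp [add_assoc, CharTwo.add_self_eq_zero]

variable [Fintype K]

lemma tr2_nondeg {n : ℕ} (hc : Fintype.card K = 2 ^ n) {a : K} (ha : a ≠ 0) :
    ∃ b : K, tr2 n (a * b) = 1 := by
  have hn : ∀ x : K, x ^ 2 ^ n = x := fun x => by rw [← hc]; exact FiniteField.pow_card x
  have : Fact (Nat.Prime 2) := ⟨Nat.prime_two⟩
  let : Algebra (ZMod 2) K := ZMod.algebra K 2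
  have hr : ringChar K = 2 := ringChar.eq K 2
  have hfr : Module.finrank (ZMod 2) K = n := by
    have := Module.card_eq_pow_finrank (K := ZMod 2) (V := K)
    rw [hc, ZMod.card] at this
    exact (Nat.pow_right_injective le_rfl this).symm
  have htr := (traceForm_nondegenerate (ZMod 2) K).1 a
  by_contra! hf
  apply ha
  apply htr
  intro b
  rw [Algebra.traceForm_apply]
  apply (algebraMap (ZMod 2) K).injective
  rw [FiniteField.algebraMap_trace_eq_sum_pow, hfr, map_zero, Nat.card_zmod]
  exact (tr2_zero_or_one hn _).resolve_right (hf b)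

lemma sum_chi {n : ℕ} (hc : Fintype.card K = 2 ^ n) (a : K) :
    ∑ x : K, chi n (a * x) = if a = 0 then (2 : ℤ) ^ n else 0 := by
  have hn : ∀ x : K, x ^ 2 ^ n = x := fun x => by rw [← hc]; exact FiniteField.pow_card x
  split_ifs with h
  · subst h
    simp [chi_zero, hc]
  · obtain ⟨b, hb⟩ := tr2_nondeg hc h
    refine sum_zero _ _ b (by simp) ?_
    intro x _
    rw [mul_add, chi_add hn]
    simp [chi, hb]

lemma card_fix {n d : ℕ} (hc : Fintype.card K = 2 ^ n) (hd : d ∣ n) (hd0 : 0 < d) :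
    #{x : K | x ^ 2 ^ d = x} = 2 ^ d := by
  open Polynomial in
  have hsp : (X ^ 2 ^ n - X : K[X]).Splits := by
    rw [← hc]
    rw [splits_iff_card_roots, FiniteField.roots_X_pow_card_sub_X,
      FiniteField.X_pow_card_sub_X_natDegree_eq _ Fintype.one_lt_card]
    rfl
  have hne : (X ^ 2 ^ n - X : K[X]) ≠ 0 := by
    rw [← hc]; exact FiniteField.X_pow_card_sub_X_ne_zero K Fintype.one_lt_card
  have h1 : (X ^ 2 ^ d - X : K[X]).Splits :=
    hsp.of_dvd hne (dvd_pow_pow_sub_self_of_dvd hd)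
  have hlt : 1 < 2 ^ d := Nat.one_lt_two_pow hd0.ne'
  have h2 := h1.natDegree_eq_card_roots
  rw [FiniteField.X_pow_card_sub_X_natDegree_eq _ hlt] at h2
  have h3 : (X ^ 2 ^ d - X : K[X]).roots.Nodup :=
    nodup_roots (galois_poly_separable 2 _ (dvd_pow_self 2 hd0.ne'))
  refine Eq.trans ?_ ((Multiset.toFinset_card_of_nodup h3).trans h2.symm)
  congr 1
  ext x
  simp [mem_roots (FiniteField.X_pow_card_sub_X_ne_zero K hlt), sub_eq_zero]

end field

section forms
variable {K : Type*} [Field K] [CharP K 2] [PerfectRing K 2]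

lemma tr_RF {n : ℕ} (hn : ∀ x : K, x ^ 2 ^ n = x) (k e : ℕ) (b : ℕ → K) (x : K) :
    tr2 n (x * RF k e b x) = tr2 n (E2 (e + 1) (fun i => b i * x ^ (2 ^ k) ^ i)) := by
  have hterm : ∀ i j : ℕ, tr2 n (x * (rt K (k * j) (b j * b (j + i)) * x ^ (2 ^ k) ^ i)) =
      tr2 n ((b j * x ^ (2 ^ k) ^ j) * (b (j + i) * x ^ (2 ^ k) ^ (j + i))) := by
    intro i j
    rw [← tr2_pow hn (k * j), mul_pow, mul_pow, rt_pow]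
    congr 1
    rw [← pow_mul, pow_mul 2 k j, pow_add (2 ^ k) j i, mul_comm ((2 ^ k) ^ i)]
    ring
  simp only [RF, aRF, E2, sum_mul, mul_sum, tr2_sum, hterm]
  rw [sum_sigma', sum_sigma']
  refine sum_nbij' (fun p => ⟨p.2 + p.1, p.2⟩) (fun p => ⟨p.1 - p.2, p.2⟩) ?_ ?_ ?_ ?_ ?_
  · rintro ⟨i, j⟩ h
    simp only [mem_sigma, mem_Icc, mem_range] at h ⊢
    omega
  · rintro ⟨i, j⟩ h
    simp only [mem_sigma, mem_Icc, mem_range] at h ⊢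
    omega
  · rintro ⟨i, j⟩ h
    simp
  · rintro ⟨i, j⟩ h
    simp only [mem_sigma, mem_range] at h
    have : j + (i - j) = i := by omega
    simp [this]
  · rintro ⟨i, j⟩ h
    rfl

lemma E2_gamma (k e : ℕ) (b : ℕ → K) (x : K) :
    E2 (e + 1) (fun i => rt K (k * i) (b i) * x) = gammaF k e b * x ^ 2 := by
  simp only [E2, gammaF, sum_mul]
  rw [sum_comm' (t' := range (e + 1)) (s' := fun i => Ioo i (e + 1))]
  · refine sum_congr rfl fun i _ => sum_congr rfl fun j _ => by ring
  · intro i j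
    simp only [mem_range, mem_Ioo]
    omega

lemma tr_adj {n : ℕ} (hn : ∀ x : K, x ^ 2 ^ n = x) (k e : ℕ) (b : ℕ → K) (x y : K) :
    tr2 n (y * Lpoly (2 ^ k) e b x) = tr2 n (adj k e b y * x) := by
  simp only [Lpoly, adj, mul_sum, sum_mul, tr2_sum]
  refine sum_congr rfl fun i _ => ?_
  rw [← tr2_pow hn (k * i) (rt K _ _ * x), mul_pow, rt_pow, pow_mul]
  congr 1
  ring

lemma tr_RFt {n : ℕ} (hn : ∀ x : K, x ^ 2 ^ n = x) (k e : ℕ) (b : ℕ → K) (t x : K)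
    (h1 : adj k e b 1 = 0) :
    tr2 n (x * RFt k e b t x) =
      ss n (Lpoly (2 ^ k) e b x) + tr2 n (t * Lpoly (2 ^ k) e b x) := by
  have e1 : x * RFt k e b t x = x * RF k e b x + gammaF k e b * x ^ 2 + (adj k e b t * x) ^ 2 := by
    simp only [RFt, alphaF]; ring
  rw [e1, tr2_add, tr2_add, tr2_sq hn, ← tr_adj hn, tr_RF hn, ← E2_gamma]
  congr 1
  have hu := ss_sum n (e + 1) (fun i => b i * x ^ (2 ^ k) ^ i)
  have hv := ss_sum n (e + 1) (fun i => rt K (k * i) (b i) * x)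
  have huv : ∀ i, b i * x ^ (2 ^ k) ^ i = (rt K (k * i) (b i) * x) ^ 2 ^ (k * i) := by
    intro i
    rw [mul_pow, rt_pow, pow_mul]
  have h0 : ∑ i ∈ range (e + 1), rt K (k * i) (b i) * x = 0 := by
    rw [← sum_mul]
    simp only [adj, mul_one] at h1
    rw [h1, zero_mul]
  rw [h0, ss_zero] at hv
  have hs : ∀ i, ss n (b i * x ^ (2 ^ k) ^ i) = ss n (rt K (k * i) (b i) * x) := fun i => by
    rw [huv, ss_pow hn]
  have ht : ∀ i, tr2 n (b i * x ^ (2 ^ k) ^ i) = tr2 n (rt K (k * i) (b i) * x) := fun i => by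
    rw [huv, tr2_pow hn]
  simp only [hs, ht] at hu
  have h2 : (2 : K) = 0 := CharTwo.two_eq_zero
  rw [Lpoly, hu]
  linear_combination hv + tr2 n (E2 (e + 1) (fun i => b i * x ^ (2 ^ k) ^ i)) * h2

lemma Lpoly_add (k e : ℕ) (b : ℕ → K) (x y : K) :
    Lpoly (2 ^ k) e b (x + y) = Lpoly (2 ^ k) e b x + Lpoly (2 ^ k) e b y := by
  simp only [Lpoly, ← pow_mul, add_pow2, mul_add, sum_add_distrib]

lemma Lpoly_zero (k e : ℕ) (b : ℕ → K) : Lpoly (2 ^ k) e b 0 = 0 := by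
  simp [Lpoly]

lemma adj_bar (k e : ℕ) (b : ℕ → K) (x : K) :
    adjBar k e b (algebraMap K (AlgebraicClosure K) x) =
      algebraMap K (AlgebraicClosure K) (adj k e b x) := by
  simp only [adjBar, adj, map_sum]
  refine sum_congr rfl fun i _ => ?_
  apply pow2_inj (k * i)
  rw [rt_pow, ← map_pow, rt_pow, map_mul]

lemma adj_zero (k e : ℕ) (b : ℕ → K) : adj k e b 0 = 0 := by
  simp only [adj, mul_zero]
  refine sum_eq_zero fun i _ => ?_
  apply pow2_inj (k * i)
  rw [rt_pow]; simp

lemma RFt_smul (k e : ℕ) (b : ℕ → K) (t d x : K) (hd : d ^ 2 ^ k = d) :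
    RFt k e b t (d * x) = d * RFt k e b t x := by
  have hd' : ∀ i, d ^ (2 ^ k) ^ i = d := by
    intro i
    induction i with
    | zero => simp
    | succ i ih => rw [pow_succ, pow_mul, ih, hd]
  simp only [RFt, RF, mul_pow, hd', mul_add, mul_sum]
  congr 1
  · exact sum_congr rfl fun i _ => by ring
  · ring

open Polynomial in
lemma card_ker [Fintype K] (k e : ℕ) (hk : 1 ≤ k) (b : ℕ → K)
    (hb1 : b 0 * b e ≠ 0)
    (hb4 : ∀ x : AlgebraicClosure K, adjBar k e b (LpolyBar k e b x) = 0 →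
      x ∈ Set.range (algebraMap K (AlgebraicClosure K))) :
    #{x : K | Lpoly (2 ^ k) e b x = 0} = (2 ^ k) ^ e := by
  have hb0 : b 0 ≠ 0 := left_ne_zero_of_mul hb1
  have hbe : b e ≠ 0 := right_ne_zero_of_mul hb1
  have hp : 1 < 2 ^ k := Nat.one_lt_two_pow (by omega)
  set P : K[X] := ∑ i ∈ range (e + 1), C (b i) * X ^ (2 ^ k) ^ i with hP
  have hdeg : P.natDegree = (2 ^ k) ^ e := by
    apply natDegree_eq_of_le_of_coeff_ne_zero
    · refine natDegree_sum_le_of_forall_le _ _ fun i hi => ?_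
      refine (natDegree_C_mul_X_pow_le _ _).trans ?_
      exact Nat.pow_le_pow_right (by omega) (by simp at hi; omega)
    · rw [hP, finsetSum_coeff, sum_eq_single e]
      · simpa using hbe
      · intro i _ hie
        rw [coeff_C_mul_X_pow, if_neg]
        intro h
        exact hie (Nat.pow_right_injective hp h).symm
      · simp
  have hder : derivative P = C (b 0) := by
    rw [hP, derivative_sum, sum_eq_single 0]
    · simp
    · intro i _ hi
      rw [derivative_C_mul_X_pow]
      have : (((2 ^ k) ^ i : ℕ) : K) = 0 := by
        rw [CharP.cast_eq_zero_iff K 2]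
        exact dvd_pow (dvd_pow_self 2 (by omega)) hi
      rw [this]; simp
    · simp
  have hsep : P.Separable := by
    rw [Separable, hder]
    exact ⟨0, C (b 0)⁻¹, by rw [zero_mul, zero_add, ← C_mul, inv_mul_cancel₀ hb0, C_1]⟩
  have hev : ∀ x : K, P.eval x = Lpoly (2 ^ k) e b x := by
    intro x; simp [hP, Lpoly, eval_finsetSum]
  have hev' : ∀ x : AlgebraicClosure K, aeval x P = LpolyBar k e b x := by
    intro x; simp [hP, Lpoly, LpolyBar]
  have hP0 : P ≠ 0 := hsep.ne_zero
  have hc := card_rootSet_eq_natDegree (K := AlgebraicClosure K) hsep (IsAlgClosed.splits _)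
  rw [hdeg] at hc
  rw [← hc, Fintype.card_eq_nat_card, Nat.card_coe_set_eq]
  have : P.rootSet (AlgebraicClosure K) = (algebraMap K (AlgebraicClosure K)) ''
      (({x : K | Lpoly (2 ^ k) e b x = 0} : Finset K) : Set K) := by
    ext x
    rw [mem_rootSet_of_ne hP0]
    constructor
    · intro h
      obtain ⟨y, rfl⟩ := hb4 x (by
        rw [← hev', h]; exact adj_zero _ _ _)
      refine ⟨y, ?_, rfl⟩
      rw [aeval_algebraMap_apply] at h
      simpa [← hev] using h
    · rintro ⟨y, hy, rfl⟩
      rw [aeval_algebraMap_apply]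
      simpa [← hev] using hy
  rw [this, Set.ncard_image_of_injective _ (algebraMap K _).injective, Set.ncard_coe_finset]

end forms

section count
variable {K : Type*} [Field K] [CharP K 2] [PerfectRing K 2] [Fintype K]

lemma card_fiber {h k e : ℕ} (hc : Fintype.card K = 2 ^ (h + h)) (b : ℕ → K)
    (hsub : ∀ v : K, adj k e b v = 0 → v ^ 2 ^ h = v) (c : K) (hcr : c ^ 2 ^ h = c) :
    #{x : K | Lpoly (2 ^ k) e b x = c} = #{y : K | adj k e b y = 0} := by
  have hn : ∀ x : K, x ^ 2 ^ (h + h) = x := fun x => by rw [← hc]; exact FiniteField.pow_card x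
  have h1 : ∑ x : K, ∑ y : K, chi (h + h) ((Lpoly (2 ^ k) e b x + c) * y) =
      (2 : ℤ) ^ (h + h) * #{x : K | Lpoly (2 ^ k) e b x = c} := by
    simp only [sum_chi hc, CharTwo.add_eq_zero]
    rw [← sum_filter, sum_const, nsmul_eq_mul, mul_comm]
  have h2 : ∑ x : K, ∑ y : K, chi (h + h) ((Lpoly (2 ^ k) e b x + c) * y) =
      (2 : ℤ) ^ (h + h) * #{y : K | adj k e b y = 0} := by
    rw [sum_comm]
    have : ∀ y : K, ∑ x : K, chi (h + h) ((Lpoly (2 ^ k) e b x + c) * y) =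
        if adj k e b y = 0 then (2 : ℤ) ^ (h + h) else 0 := by
      intro y
      have e1 : ∀ x : K, chi (h + h) ((Lpoly (2 ^ k) e b x + c) * y) =
          chi (h + h) (adj k e b y * x) * chi (h + h) (c * y) := by
        intro x
        rw [add_mul, chi_add hn, mul_comm (Lpoly _ _ _ _), chi_of_tr (tr_adj hn k e b x y)]
      simp only [e1]
      rw [← sum_mul, sum_chi hc]
      split_ifs with hy
      · have : chi (h + h) (c * y) = 1 := by
          rw [chi, if_pos]
          apply tr2_double_sub
          rw [mul_pow, hcr, hsub y hy]
        rw [this, mul_one]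
      · simp
    simp only [this]
    rw [← sum_filter, sum_const, nsmul_eq_mul, mul_comm]
  have h3 := h1.symm.trans h2
  have h4 : ((2 : ℤ) ^ (h + h)) ≠ 0 := by positivity
  exact_mod_cast mul_left_cancel₀ h4 h3

lemma main_sum {h k e : ℕ} (hh : 0 < h) (hc : Fintype.card K = 2 ^ (h + h)) (b : ℕ → K)
    (hsub : ∀ v : K, adj k e b v = 0 → v ^ 2 ^ h = v)
    (h1 : adj k e b 1 = 0)
    (hker : #{x : K | Lpoly (2 ^ k) e b x = 0} = (2 ^ k) ^ e)
    (t : K) (ht : t ^ 2 ^ h + t = 1) :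
    ∑ x : K, chi (h + h) (x * RFt k e b t x) = (2 ^ k) ^ e * 2 ^ h := by
  have hn : ∀ x : K, x ^ 2 ^ (h + h) = x := fun x => by rw [← hc]; exact FiniteField.pow_card x
  set F : K → K := Lpoly (2 ^ k) e b with hF
  have hFadd : ∀ x y, F (x + y) = F x + F y := Lpoly_add k e b
  have hfib : ∀ c : K, c ^ 2 ^ h = c → #{x : K | F x = c} = (2 ^ k) ^ e := by
    intro c hcr
    rw [card_fiber hc b hsub c hcr, ← hker]
    exact (card_fiber hc b hsub 0 (by simp)).symm
  set X : Finset K := {x : K | F x ^ 2 ^ h = F x} with hX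
  have hmX : ∀ x, x ∈ X ↔ F x ^ 2 ^ h = F x := by intro x; simp [hX]
  have hXcard : #X = (2 ^ k) ^ e * 2 ^ h := by
    rw [card_eq_sum_card_fiberwise (f := F) (t := ({c : K | c ^ 2 ^ h = c} : Finset K))]
    · rw [sum_congr rfl (g := fun _ => (2 ^ k) ^ e)]
      · rw [sum_const, card_fix hc (by simp) hh, smul_eq_mul, mul_comm]
      · intro c hcm
        have hcr : c ^ 2 ^ h = c := by simpa using hcm
        rw [← hfib c hcr]
        congr 1
        ext x
        simp only [mem_filter, hmX, mem_univ, true_and]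
        constructor
        · exact fun h => h.2
        · rintro rfl; exact ⟨hcr, rfl⟩
    · intro x hx
      simpa [hX] using hx
  have h20 : (2 : K) = 0 := CharTwo.two_eq_zero
  have hq0 : ∀ a ∈ X, ss (h + h) (F a) + tr2 (h + h) (t * F a) = 0 := by
    intro a ha
    rw [hmX] at ha
    rw [ss_double_sub h _ ha, tr2_t h _ t ha ht, CharTwo.add_self_eq_zero]
  have hqa : ∀ a ∈ X, ∀ x, chi (h + h) ((x + a) * RFt k e b t (x + a)) =
      chi (h + h) (x * RFt k e b t x) * chi (h + h) (F x * F a) := by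
    intro a ha x
    rw [← chi_add hn]
    apply chi_of_tr
    have ha' := (hmX a).mp ha
    rw [tr2_add, tr_RFt hn _ _ _ _ _ h1, tr_RFt hn _ _ _ _ _ h1, ← hF, hFadd, ss_add, mul_add,
      tr2_add, tr2_double_sub h (F a) ha']
    linear_combination hq0 a ha - tr2 (h + h) (F x * F a) * h20
  have hchi1 : ∀ x ∈ X, chi (h + h) (x * RFt k e b t x) = 1 := by
    intro x hx
    rw [chi, if_pos]
    rw [tr_RFt hn _ _ _ _ _ h1, ← hF, hq0 x hx]
  have hXadd : ∀ x ∈ X, ∀ y ∈ X, x + y ∈ X := by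
    intro x hx y hy
    rw [hmX] at *
    rw [hFadd, add_pow2, hx, hy]
  have hinner : ∀ x, ∑ a ∈ X, chi (h + h) (F x * F a) = if x ∈ X then (#X : ℤ) else 0 := by
    intro x
    split_ifs with hx
    · rw [sum_congr rfl (g := fun _ => (1 : ℤ)) ?_]
      · simp
      · intro a ha
        rw [hmX] at *
        rw [chi, if_pos]
        apply tr2_double_sub
        rw [mul_pow, hx, ha]
    · have hz : F x + F x ^ 2 ^ h ≠ 0 := by
        intro h0
        exact hx ((hmX x).mpr (CharTwo.add_eq_zero.mp h0).symm)
      obtain ⟨d, hd⟩ := tr2_nondeg hc hz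
      have hcr : (d + d ^ 2 ^ h) ^ 2 ^ h = d + d ^ 2 ^ h := by
        rw [add_pow2, ← pow_mul, ← pow_add, hn, add_comm]
      have hne : ({x : K | F x = d + d ^ 2 ^ h} : Finset K).Nonempty := by
        rw [← card_pos, hfib _ hcr]; positivity
      obtain ⟨a, ha⟩ := hne
      have ha : F a = d + d ^ 2 ^ h := by simpa using ha
      have haX : a ∈ X := by rw [hmX, ha, hcr]
      have htr : tr2 (h + h) (F x * F a) = 1 := by
        rw [← hd, ha, mul_add, add_mul, tr2_add, tr2_add]
        congr 1
        rw [← tr2_pow hn h, mul_pow, ← pow_mul, ← pow_add, hn]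
      refine sum_zero _ _ a (fun x hx => hXadd x hx a haX) ?_
      intro y hy
      rw [hFadd, mul_add, chi_add hn]
      simp [chi, htr]
  have key : (#X : ℤ) * ∑ x : K, chi (h + h) (x * RFt k e b t x) = #X * #X := by
    calc (#X : ℤ) * ∑ x : K, chi (h + h) (x * RFt k e b t x)
        = ∑ a ∈ X, ∑ x : K, chi (h + h) (x * RFt k e b t x) := by simp
      _ = ∑ a ∈ X, ∑ x : K, chi (h + h) ((x + a) * RFt k e b t (x + a)) := by
          refine sum_congr rfl fun a _ => ?_
          exact (Equiv.sum_comp (Equiv.addRight a)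
            (fun x => chi (h + h) (x * RFt k e b t x))).symm
      _ = ∑ a ∈ X, ∑ x : K, chi (h + h) (x * RFt k e b t x) * chi (h + h) (F x * F a) :=
          sum_congr rfl fun a ha => sum_congr rfl fun x _ => hqa a ha x
      _ = ∑ x : K, chi (h + h) (x * RFt k e b t x) * if x ∈ X then (#X : ℤ) else 0 := by
          rw [sum_comm]
          refine sum_congr rfl fun x _ => ?_
          rw [← mul_sum, hinner]
      _ = ∑ x : K, if x ∈ X then (#X : ℤ) else 0 := by
          refine sum_congr rfl fun x _ => ?_
          split_ifs with hx
          · rw [hchi1 x hx, one_mul]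
          · simp
      _ = #X * #X := by simp
  have hX0 : (#X : ℤ) ≠ 0 := by
    rw [hXcard]; positivity
  rw [mul_left_cancel₀ hX0 key, hXcard]
  push_cast
  rfl

lemma Ncount_eq {n k e : ℕ} (hk : 0 < k) (hkn : k ∣ n) (hc : Fintype.card K = 2 ^ n) (b : ℕ → K)
    (t : K) :
    (Ncount K (2 ^ k) (RFt k e b t) : ℤ) =
      2 ^ n + (2 ^ k - 1) * ∑ x : K, chi n (x * RFt k e b t x) := by
  have hn : ∀ x : K, x ^ 2 ^ n = x := fun x => by rw [← hc]; exact FiniteField.pow_card x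
  set R := RFt k e b t with hR
  set S := ∑ x : K, chi n (x * R x) with hS
  have hN : Ncount K (2 ^ k) R = #{z : K × K | z.2 ^ 2 ^ k - z.2 = z.1 * R z.1} := by
    rw [Ncount, Nat.card_eq_fintype_card, Fintype.card_subtype]
  have h1 : ∑ z : K × K, ∑ c : K, chi n ((z.2 ^ 2 ^ k - z.2 + z.1 * R z.1) * c) =
      2 ^ n * (Ncount K (2 ^ k) R : ℤ) := by
    simp only [sum_chi hc, CharTwo.add_eq_zero]
    rw [← sum_filter, sum_const, nsmul_eq_mul, mul_comm, hN]
  have hin : ∀ c : K, ∑ y : K, chi n ((y ^ 2 ^ k - y) * c) =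
      if c ^ 2 ^ k = c then (2 : ℤ) ^ n else 0 := by
    intro c
    have e1 : ∀ y : K, chi n ((y ^ 2 ^ k - y) * c) = chi n ((c + c ^ 2 ^ k) * y ^ 2 ^ k) := by
      intro y
      apply chi_of_tr
      rw [CharTwo.sub_eq_add, add_mul, add_mul, tr2_add, tr2_add, mul_comm c, ← mul_pow,
        tr2_pow hn, mul_comm c]
    have hbij : Function.Bijective (fun y : K => y ^ 2 ^ k) :=
      Finite.injective_iff_bijective.mp (fun x y h => pow2_inj k h)
    simp only [e1]
    rw [hbij.sum_comp (fun y => chi n ((c + c ^ 2 ^ k) * y)), sum_chi hc]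
    simp only [CharTwo.add_eq_zero, eq_comm (a := c)]
  have hSc : ∀ c : K, c ^ 2 ^ k = c → c ≠ 0 → ∑ x : K, chi n (x * R x * c) = S := by
    intro c hcp hc0
    obtain ⟨d, hd⟩ : ∃ d : K, d ^ 2 = c := ⟨rt K 1 c, by simpa using rt_pow 1 c⟩
    have hd0 : d ≠ 0 := by rintro rfl; apply hc0; rw [← hd]; simp
    have hdp : d ^ 2 ^ k = d := by
      apply pow2_inj 1
      rw [pow_one, ← pow_mul, mul_comm, pow_mul, hd, hcp]
    rw [hS, ← Equiv.sum_comp (Equiv.mulLeft₀ d hd0) (fun x => chi n (x * R x))]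
    refine sum_congr rfl fun x _ => ?_
    change _ = chi n (d * x * R (d * x))
    rw [hR, RFt_smul k e b t d x hdp, ← hd]
    congr 1
    ring
  have h2 : ∑ z : K × K, ∑ c : K, chi n ((z.2 ^ 2 ^ k - z.2 + z.1 * R z.1) * c) =
      2 ^ n * (2 ^ n + (2 ^ k - 1) * S) := by
    rw [sum_comm]
    have e2 : ∀ c : K, ∑ z : K × K, chi n ((z.2 ^ 2 ^ k - z.2 + z.1 * R z.1) * c) =
        if c ^ 2 ^ k = c then 2 ^ n * ∑ x : K, chi n (x * R x * c) else 0 := by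
      intro c
      rw [Fintype.sum_prod_type]
      simp only [add_mul, chi_add hn]
      simp only [← sum_mul, hin]
      rw [← mul_sum]
      split_ifs <;> simp
    simp only [e2]
    rw [← sum_filter, ← mul_sum]
    congr 1
    have h0m : (0 : K) ∈ ({c : K | c ^ 2 ^ k = c} : Finset K) := by simp
    rw [← add_sum_erase _ _ h0m,
      sum_congr (s₁ := ({c : K | c ^ 2 ^ k = c} : Finset K).erase 0) rfl (g := fun _ => S)]
    · rw [sum_const, card_erase_of_mem h0m, card_fix hc hkn hk, nsmul_eq_mul,
        Nat.cast_sub Nat.one_le_two_pow]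
      simp [chi_zero, hc]
    · intro c hcm
      simp only [mem_erase, mem_filter, mem_univ, true_and] at hcm
      exact hSc c hcm.2 hcm.1
  have h4 : ((2 : ℤ) ^ n) ≠ 0 := by positivity
  exact mul_left_cancel₀ h4 (h1.symm.trans h2)

end count

end Aux

/-- If `q = r²`, `W_F^* ⊆ 𝔽_r` and `t₀^r + t₀ = 1`, then `D_{F,t₀}` is
`𝔽_q`-maximal. -/
theorem statement12 {K : Type*} [Field K] [Fintype K] [CharP K 2]
    (k j m e : ℕ) (hk : 1 ≤ k) (hj : 1 ≤ j) (he : 1 ≤ e) (hm : m = 2 * j)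
    (hcard : Fintype.card K = 2 ^ (k * m))
    (b : ℕ → K)
    (hb1 : b 0 * b e ≠ 0)
    (hb2 : adjBar k e b 1 = 0)
    (hb3 : ∀ x : AlgebraicClosure K, adjBar k e b x = 0 →
      x ∈ Set.range (algebraMap K (AlgebraicClosure K)))
    (hb4 : ∀ x : AlgebraicClosure K, adjBar k e b (LpolyBar k e b x) = 0 →
      x ∈ Set.range (algebraMap K (AlgebraicClosure K)))
    (hsub : ∀ v : K, adjBar k e b (algebraMap K (AlgebraicClosure K) v) = 0 →
      v ^ 2 ^ (k * j) = v)
    (t0 : K) (ht0 : t0 ^ 2 ^ (k * j) + t0 = 1) :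
    (Ncount K (2 ^ k) (RFt k e b t0) : ℤ)
      = 2 ^ (k * m) + (2 ^ k - 1) * (2 ^ k) ^ e * 2 ^ (k * j) := by
  have hn : k * m = k * j + k * j := by rw [hm]; ring
  have hinj := (algebraMap K (AlgebraicClosure K)).injective
  have h1 : adj k e b 1 = 0 := by
    apply hinj
    rw [← Aux.adj_bar, map_one, map_zero, hb2]
  have hs : ∀ v : K, adj k e b v = 0 → v ^ 2 ^ (k * j) = v := by
    intro v hv
    apply hsub
    rw [Aux.adj_bar, hv, map_zero]
  have hc : Fintype.card K = 2 ^ (k * j + k * j) := by rw [hcard, hn]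
  rw [hn, Aux.Ncount_eq (by omega) (by simp [← mul_add]) hc,
    Aux.main_sum (Nat.mul_pos (by omega) (by omega)) hc b hs h1
      (Aux.card_ker k e hk b hb1 hb4) t0 ht0]
  ring

end
end

section
/- Let p be a power of 2 and q = p^m with m = 2m_0 even. Let a ∈ F_q, set α := Tr_{F_q/F_{p²}}(a), and let N := |{(x,y) ∈ F_q × F_q : y^p + y = x^{p+1} + a x²}|. Then: (1) if α ≠ 0, then N = q; (2) if α = 0, then β := ∑_{0 ≤ i < j ≤ m−1, i odd, j even} a^{p^i}·a^{p^j} lies in F_p, the count N equals q + (p−1)p^{1+m_0} or q − (p−1)p^{1+m_0}, and N = q + (p−1)p^{1+m_0} (the F_q-maximal value) if and only if m_0 + Tr_{F_p/F_2}(β) ≡ 1 (mod 2), where Tr_{F_p/F_2}(β) ∈ F_2 is identified with its lift in {0,1}. -/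
open Finset

open scoped Classical

noncomputable section

variable {K : Type*}

section H14
set_option linter.unusedSectionVars false
variable {F : Type*} [Field F] [Fintype F] [CharP F 2]

theorem h_add (s : ℕ) (x y : F) : (x + y) ^ 2 ^ s = x ^ 2 ^ s + y ^ 2 ^ s :=
  haveI : Fact (Nat.Prime 2) := ⟨Nat.prime_two⟩
  add_pow_char_pow x y 2 s

theorem h_sum (s : ℕ) {ι : Type*} (t : Finset ι) (f : ι → F) :
    (∑ i ∈ t, f i) ^ 2 ^ s = ∑ i ∈ t, f i ^ 2 ^ s :=
  haveI : Fact (Nat.Prime 2) := ⟨Nat.prime_two⟩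
  sum_pow_char_pow 2 s t f

theorem h_trp_add (s n : ℕ) (x y : F) : trp (2 ^ s) n (x + y) = trp (2 ^ s) n x + trp (2 ^ s) n y := by
  simp only [trp, ← pow_mul, h_add, Finset.sum_add_distrib]

theorem h_tr2_add (n : ℕ) (x y : F) : tr2 n (x + y) = tr2 n x + tr2 n y := by
  simp only [tr2, h_add, Finset.sum_add_distrib]

theorem h_trp_frob (s n : ℕ) (hc : Fintype.card F = (2 ^ s) ^ n) (x : F) :
    trp (2 ^ s) n (x ^ 2 ^ s) = trp (2 ^ s) n x := by
  have h1 : trp (2 ^ s) n (x ^ 2 ^ s) + x = trp (2 ^ s) n x + x := by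
    have e1 := Finset.sum_range_succ' (fun i => x ^ (2 ^ s) ^ i) n
    have e2 := Finset.sum_range_succ (fun i => x ^ (2 ^ s) ^ i) n
    rw [e1] at e2
    simp only [pow_zero, pow_one, ← hc, FiniteField.pow_card] at e2
    simp only [trp]
    rw [← e2]
    congr 1
    refine Finset.sum_congr rfl fun i _ => ?_
    rw [← pow_mul, pow_succ']
  exact add_right_cancel h1

theorem h_trp_pow (s n : ℕ) (hc : Fintype.card F = (2 ^ s) ^ n) (x : F) :
    (trp (2 ^ s) n x) ^ 2 ^ s = trp (2 ^ s) n x := by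
  rw [← h_trp_frob s n hc x]
  conv_rhs => rw [← h_trp_frob s n hc]
  simp only [trp]
  rw [h_sum]
  refine Finset.sum_congr rfl fun i _ => ?_
  ring

theorem h_trp_one (n : ℕ) (x : F) : trp (2 ^ 1) n x = tr2 n x := by simp [trp, tr2]

theorem h_tower (s n : ℕ) (x : F) : tr2 (s * n) x = tr2 s (trp (2 ^ s) n x) := by
  induction n with
  | zero => simp [tr2, trp]
  | succ n ih =>
    have : trp (2 ^ s) (n + 1) x = trp (2 ^ s) n x + x ^ (2 ^ s) ^ n := by
      simp only [trp, Finset.sum_range_succ]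
    rw [this, h_tr2_add, ← ih]
    simp only [tr2]
    rw [Nat.mul_succ, Finset.sum_range_add]
    congr 1
    refine Finset.sum_congr rfl fun i _ => ?_
    rw [← pow_mul, ← pow_mul, pow_add]

/-- kernel of trace bound -/
theorem h_kerT (s n : ℕ) (hs : 1 ≤ s) (hn : 1 ≤ n) :
    (Finset.univ.filter (fun x : F => trp (2 ^ s) n x = 0)).card ≤ (2 ^ s) ^ (n - 1) := by
  set P : Polynomial F := ∑ i ∈ Finset.range n, Polynomial.X ^ (2 ^ s) ^ i with hP
  have h2 : 2 ≤ 2 ^ s := by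
    calc 2 = 2 ^ 1 := rfl
      _ ≤ 2 ^ s := Nat.pow_le_pow_right (by norm_num) hs
  have hP0 : P ≠ 0 := by
    intro h
    have : P.coeff 1 = 1 := by
      rw [hP, Polynomial.finsetSum_coeff, Finset.sum_eq_single 0]
      · simp
      · intro i _ hi
        rw [Polynomial.coeff_X_pow, if_neg]
        have := Nat.one_lt_pow hi h2
        omega
      · intro h; simp at h; omega
    rw [h] at this; simp at this
  have hdeg : P.natDegree ≤ (2 ^ s) ^ (n - 1) := by
    refine Polynomial.natDegree_sum_le_of_forall_le _ _ fun i hi => ?_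
    rw [Polynomial.natDegree_X_pow]
    have := Finset.mem_range.1 hi
    exact Nat.pow_le_pow_right (by omega) (by omega)
  refine le_trans ?_ hdeg
  refine Polynomial.card_le_degree_of_subset_roots (p := P) ?_
  intro x hx
  rw [Polynomial.mem_roots hP0]
  have : trp (2 ^ s) n x = 0 := by simpa using hx
  rw [Polynomial.IsRoot.def, hP, Polynomial.eval_finsetSum]
  simpa [trp] using this

theorem h_kerL (s : ℕ) (hs : 1 ≤ s) :
    (Finset.univ.filter (fun x : F => x ^ 2 ^ s = x)).card ≤ 2 ^ s := by
  have h2 : 1 < 2 ^ s := Nat.one_lt_pow (by omega) (by norm_num)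
  have hP0 := FiniteField.X_pow_card_sub_X_ne_zero F h2
  refine le_trans ?_ (FiniteField.X_pow_card_sub_X_natDegree_eq F h2).le
  refine Polynomial.card_le_degree_of_subset_roots ?_
  intro x hx
  rw [Polynomial.mem_roots hP0]
  have : x ^ 2 ^ s = x := by simpa using hx
  simp [this]

theorem h_main (s n : ℕ) (hs : 1 ≤ s) (hn : 1 ≤ n) (hc : Fintype.card F = (2 ^ s) ^ n) :
    (Finset.univ.filter (fun x : F => x ^ 2 ^ s = x)).card = 2 ^ s ∧
    ∀ a : F, trp (2 ^ s) n a = 0 → ∃ d, a = d ^ 2 ^ s + d := by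
  let L : F →+ F := AddMonoidHom.mk' (fun x => x ^ 2 ^ s + x) (fun x y => by rw [h_add]; ring)
  have hk : (Finset.univ.filter (fun x : F => x ^ 2 ^ s = x)).card = Nat.card L.ker := by
    rw [Nat.card_eq_fintype_card]
    refine (Fintype.card_of_subtype _ fun x => ?_).symm
    simp [L, AddMonoidHom.mem_ker, CharTwo.add_eq_zero]
  have hkl := h_kerL (F := F) s hs
  have hkt := h_kerT (F := F) s n hs hn
  have hprod : Nat.card L.ker * Nat.card L.range = (2 ^ s) ^ n := by
    rw [← hc, ← Nat.card_eq_fintype_card, mul_comm]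
    have := AddSubgroup.card_eq_card_quotient_mul_card_addSubgroup L.ker
    rw [this, Nat.card_congr (QuotientAddGroup.quotientKerEquivRange L).toEquiv]
  have hr : Nat.card L.range = (Finset.univ.filter (fun x : F => x ∈ L.range)).card := by
    rw [Nat.card_eq_fintype_card]
    refine Fintype.card_of_subtype _ fun x => ?_
    simp
  have hsub : Finset.univ.filter (fun x : F => x ∈ L.range) ⊆
      Finset.univ.filter (fun x : F => trp (2 ^ s) n x = 0) := by
    intro x hx
    simp only [Finset.mem_filter, Finset.mem_univ, true_and] at hx ⊢
    obtain ⟨d, rfl⟩ := hx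
    change trp (2 ^ s) n (d ^ 2 ^ s + d) = 0
    rw [h_trp_add, h_trp_frob s n hc, CharTwo.add_self_eq_zero]
  have hle := Finset.card_le_card hsub
  have hpow : (2 ^ s) ^ n = 2 ^ s * (2 ^ s) ^ (n - 1) := by
    rw [← pow_succ']; congr 1; omega
  have hA : 0 < 2 ^ s := by positivity
  have hB : 0 < (2 ^ s) ^ (n - 1) := by positivity
  rw [hr, ← hk, hpow] at hprod
  set A := 2 ^ s
  set B := A ^ (n - 1)
  set c1 := (Finset.univ.filter (fun x : F => x ^ A = x)).card
  set c2 := (Finset.univ.filter (fun x : F => x ∈ L.range)).card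
  set c3 := (Finset.univ.filter (fun x : F => trp A n x = 0)).card
  have h1 : c1 = A := by
    refine le_antisymm hkl ?_
    by_contra hh
    push Not at hh
    have : c1 * c2 ≤ c1 * B := Nat.mul_le_mul_left _ (hle.trans hkt)
    have : c1 * B < A * B := Nat.mul_lt_mul_of_pos_right hh hB
    omega
  refine ⟨h1, ?_⟩
  have h2 : c2 = B := by
    rw [h1] at hprod
    exact Nat.eq_of_mul_eq_mul_left hA hprod
  have heq := Finset.eq_of_subset_of_card_le hsub (by omega)
  intro a ha
  have : a ∈ Finset.univ.filter (fun x : F => x ∈ L.range) := by rw [heq]; simpa using ha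
  simp only [Finset.mem_filter, Finset.mem_univ, true_and] at this
  obtain ⟨d, hd⟩ := this
  exact ⟨d, hd.symm⟩

/-- integer valued additive character -/
def h_psi (n : ℕ) (x : F) : ℤ := if tr2 n x = 0 then 1 else -1

theorem h_tr2_01 (n : ℕ) (hc : Fintype.card F = 2 ^ n) (x : F) : tr2 n x = 0 ∨ tr2 n x = 1 := by
  have := h_trp_pow 1 n (by simpa using hc) x
  rw [h_trp_one] at this
  have h : tr2 n x * (tr2 n x - 1) = 0 := by
    rw [pow_one] at this
    linear_combination this
  rcases mul_eq_zero.1 h with h | h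
  · exact Or.inl h
  · exact Or.inr (sub_eq_zero.1 h)

theorem h_psi_add (n : ℕ) (hc : Fintype.card F = 2 ^ n) (x y : F) :
    h_psi n (x + y) = h_psi n x * h_psi n y := by
  unfold h_psi
  rw [h_tr2_add]
  rcases h_tr2_01 n hc x with h | h <;> rcases h_tr2_01 n hc y with h' | h' <;>
    simp [h, h', CharTwo.add_self_eq_zero]

theorem h_psi_zero (n : ℕ) : h_psi n (0 : F) = 1 := by
  simp [h_psi, tr2]

theorem h_psi_sq (n : ℕ) (x : F) : h_psi n x * h_psi n x = 1 := by
  unfold h_psi; split_ifs <;> norm_num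

theorem h_psi_frob (n : ℕ) (hc : Fintype.card F = 2 ^ n) (x : F) (s : ℕ) :
    h_psi n (x ^ 2 ^ s) = h_psi n x := by
  induction s with
  | zero => simp
  | succ s ih =>
    rw [← ih, pow_succ, pow_mul]
    have := h_trp_frob 1 n (by simpa using hc) (x ^ 2 ^ s)
    rw [h_trp_one, h_trp_one, pow_one] at this
    simp only [h_psi, this]

theorem h_psi_nontriv (n : ℕ) (hn : 1 ≤ n) (hc : Fintype.card F = 2 ^ n) :
    ∃ x : F, tr2 n x = 1 := by
  have h := h_kerT (F := F) 1 n le_rfl hn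
  by_contra hh
  push Not at hh
  have : Finset.univ.filter (fun x : F => trp (2 ^ 1) n x = 0) = Finset.univ := by
    ext x
    simp only [h_trp_one, Finset.mem_filter, Finset.mem_univ, true_and, iff_true]
    exact (h_tr2_01 n hc x).resolve_right (hh x)
  rw [this, Finset.card_univ, hc, pow_one] at h
  have := Nat.pow_lt_pow_right (a := 2) (by norm_num) (show n - 1 < n by omega)
  omega

theorem h_orth (n : ℕ) (hn : 1 ≤ n) (hc : Fintype.card F = 2 ^ n) (c : F) :
    ∑ x : F, h_psi n (c * x) = if c = 0 then 2 ^ n else 0 := by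
  split_ifs with h
  · simp [h, h_psi_zero, hc]
  · obtain ⟨u, hu⟩ := h_psi_nontriv (F := F) n hn hc
    have e : ∑ x : F, h_psi n (c * (x + u / c)) = ∑ x : F, h_psi n (c * x) :=
      Equiv.sum_comp (Equiv.addRight (u / c)) (fun x => h_psi n (c * x))
    have hu' : h_psi n u = -1 := by simp [h_psi, hu]
    simp only [mul_add, mul_div_cancel₀ _ h, h_psi_add n hc, hu', ← Finset.sum_mul] at e
    linarith

theorem h_bij (s : ℕ) : Function.Bijective (fun x : F => x ^ 2 ^ s) := by
  refine Finite.injective_iff_bijective.1 ?_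
  intro x y hxy
  simp only at hxy
  have : (x + y) ^ 2 ^ s = 0 := by rw [h_add, hxy, CharTwo.add_self_eq_zero]
  exact CharTwo.add_eq_zero.1 (pow_eq_zero_iff (by positivity) |>.1 this)

theorem h_filter_even {M : Type*} [AddCommMonoid M] (g : ℕ → M) (n : ℕ) :
    ∑ j ∈ (Finset.range (2 * n)).filter (fun j => j % 2 = 0), g j = ∑ j ∈ Finset.range n, g (2 * j) := by
  induction n with
  | zero => simp
  | succ n ih =>
    rw [Finset.sum_range_succ, ← ih, Finset.sum_filter, Finset.sum_filter,
      show 2 * (n + 1) = 2 * n + 1 + 1 by ring, Finset.sum_range_succ, Finset.sum_range_succ,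
      if_pos (by omega), if_neg (by omega), add_zero]

theorem h_filter_odd {M : Type*} [AddCommMonoid M] (g : ℕ → M) (n : ℕ) :
    ∑ j ∈ (Finset.range (2 * n)).filter (fun j => j % 2 = 1), g j = ∑ j ∈ Finset.range n, g (2 * j + 1) := by
  induction n with
  | zero => simp
  | succ n ih =>
    rw [Finset.sum_range_succ, ← ih, Finset.sum_filter, Finset.sum_filter,
      show 2 * (n + 1) = 2 * n + 1 + 1 by ring, Finset.sum_range_succ, Finset.sum_range_succ,
      if_neg (by omega), if_pos (by omega), add_zero]

theorem h_tele (e : ℕ → F) (M : ℕ) :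
    ∑ i ∈ Finset.range M, (e (2 * i + 1) + e (2 * i + 1 + 2)) = e 1 + e (2 * M + 1) := by
  induction M with
  | zero => simp [CharTwo.add_self_eq_zero]
  | succ M ih =>
    rw [Finset.sum_range_succ, ih]
    have := CharTwo.add_self_eq_zero (e (2 * M + 1))
    rw [show 2 * (M + 1) + 1 = 2 * M + 1 + 2 by ring]
    linear_combination this

theorem h_beta_aux (e : ℕ → F) (M : ℕ) :
    ∑ j ∈ Finset.range M, ∑ i ∈ Finset.range j,
      (e (2 * i + 1) + e (2 * i + 1 + 2)) * (e (2 * j) + e (2 * j + 2)) =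
    ∑ j ∈ Finset.range (2 * M), e j * e (j + 1) + e 1 * (e 0 + e (2 * M)) := by
  induction M with
  | zero => simp [CharTwo.add_self_eq_zero]
  | succ M ih =>
    rw [Finset.sum_range_succ, ih, ← Finset.sum_mul, h_tele,
      show 2 * (M + 1) = 2 * M + 1 + 1 by ring, Finset.sum_range_succ, Finset.sum_range_succ]
    have := CharTwo.add_self_eq_zero (e 1 * e (2 * M))
    linear_combination this

theorem h_beta (k m0 : ℕ) (hcard : Fintype.card F = 2 ^ (k * (2 * m0))) (a d : F)
    (hd : a = d ^ 2 ^ (2 * k) + d) :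
    (∑ jj ∈ (Finset.range (2 * m0)).filter (fun jj => jj % 2 = 0),
          ∑ ii ∈ (Finset.range jj).filter (fun ii => ii % 2 = 1),
            a ^ (2 ^ k) ^ ii * a ^ (2 ^ k) ^ jj) = trp (2 ^ k) (2 * m0) (d ^ (2 ^ k + 1)) := by
  rw [h_filter_even]
  simp only [h_filter_odd]
  set e : ℕ → F := fun i => d ^ (2 ^ k) ^ i with he
  have ha : ∀ i, a ^ (2 ^ k) ^ i = e i + e (i + 2) := by
    intro i
    rw [hd, ← pow_mul, h_add, he]
    simp only
    rw [add_comm]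
    congr 1
    · rw [pow_mul]
    · rw [← pow_mul]; congr 1; ring
  simp only [ha]
  rw [h_beta_aux]
  have h0 : e (2 * m0) = e 0 := by
    simp only [he]
    rw [← pow_mul, ← hcard, FiniteField.pow_card]; simp
  rw [h0, CharTwo.add_self_eq_zero, mul_zero, add_zero]
  simp only [trp]
  refine Finset.sum_congr rfl fun i _ => ?_
  simp only [he]
  ring

/-- the exponential sum -/
def h_S (k n : ℕ) (a : F) : ℤ := ∑ x : F, h_psi n (x ^ (2 ^ k + 1) + a * x ^ 2)

theorem h_count (k n : ℕ) (hn : 1 ≤ n) (hc : Fintype.card F = 2 ^ n)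
    (hp : (Finset.univ.filter (fun x : F => x ^ 2 ^ k = x)).card = 2 ^ k) (a : F) :
    (Nat.card {z : F × F // z.2 ^ 2 ^ k + z.2 = z.1 ^ (2 ^ k + 1) + a * z.1 ^ 2} : ℤ)
      = 2 ^ n + (2 ^ k - 1) * h_S k n a := by
  set f : F → F := fun x => x ^ (2 ^ k + 1) + a * x ^ 2 with hf
  have h1 : (2 : ℤ) ^ n * (Nat.card {z : F × F // z.2 ^ 2 ^ k + z.2 = f z.1} : ℤ)
      = ∑ s : F, ∑ x : F, ∑ y : F, h_psi n (s * (y ^ 2 ^ k + y + f x)) := by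
    rw [Nat.card_eq_fintype_card, Fintype.card_subtype, Finset.card_filter]
    push_cast
    rw [Finset.mul_sum, Fintype.sum_prod_type, Finset.sum_comm]
    rw [Finset.sum_comm]
    conv_rhs => rw [Finset.sum_comm]
    refine Finset.sum_congr rfl fun x _ => ?_
    conv_rhs => rw [Finset.sum_comm]
    refine Finset.sum_congr rfl fun y _ => ?_
    have := h_orth n hn hc (y ^ 2 ^ k + y + f x)
    simp only [mul_comm _ (y ^ 2 ^ k + y + f x)]
    rw [this]
    simp only [CharTwo.add_eq_zero]
    split_ifs <;> simp
  have h2 : ∀ s : F, ∑ x : F, ∑ y : F, h_psi n (s * (y ^ 2 ^ k + y + f x)) =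
      if s ^ 2 ^ k = s then 2 ^ n * ∑ x : F, h_psi n (s * f x) else 0 := by
    intro s
    have h3 : ∑ y : F, h_psi n (s * (y ^ 2 ^ k + y)) = if s ^ 2 ^ k = s then 2 ^ n else 0 := by
      have : ∀ y, h_psi n (s * (y ^ 2 ^ k + y)) = h_psi n ((s ^ 2 ^ k + s) * y ^ 2 ^ k) := by
        intro y
        rw [mul_add, add_mul, h_psi_add n hc, h_psi_add n hc, ← mul_pow, h_psi_frob n hc (s * y),
          mul_comm]
      simp only [this]
      rw [Function.Bijective.sum_comp (h_bij k) (fun y => h_psi n ((s ^ 2 ^ k + s) * y)),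
        h_orth n hn hc]
      simp only [CharTwo.add_eq_zero]
    simp only [mul_add s _ (f _), h_psi_add n hc _ (s * f _), ← Finset.sum_mul, h3]
    rw [← Finset.mul_sum]
    split_ifs <;> simp
  have h4 : ∀ s : F, s ^ 2 ^ k = s → s ≠ 0 → ∑ x : F, h_psi n (s * f x) = h_S k n a := by
    intro s hs hs0
    obtain ⟨t, ht⟩ := (h_bij (F := F) 1).2 s
    simp only [pow_one] at ht
    have ht0 : t ≠ 0 := by rintro rfl; simp at ht; exact hs0 ht.symm
    have htp : t ^ 2 ^ k = t := by
      apply (h_bij (F := F) 1).1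
      simp only [pow_one]
      rw [← pow_mul, mul_comm, pow_mul, ht, hs]
    have e : ∑ x : F, h_psi n (f (t * x)) = ∑ x : F, h_psi n (f x) :=
      Equiv.sum_comp (Equiv.mulLeft₀ t ht0) (fun x => h_psi n (f x))
    rw [h_S, ← e]
    refine Finset.sum_congr rfl fun x _ => ?_
    congr 1
    simp only [hf]
    rw [mul_pow, pow_succ t, htp, ← ht]
    ring
  simp only [h2] at h1
  have h5 : ∑ s : F, (if s ^ 2 ^ k = s then (2 : ℤ) ^ n * ∑ x : F, h_psi n (s * f x) else 0)
      = 2 ^ n * (2 ^ n + (2 ^ k - 1) * h_S k n a) := by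
    rw [← Finset.sum_filter, ← Finset.mul_sum]
    congr 1
    rw [← Finset.add_sum_erase _ _ (show (0 : F) ∈ _ by simp)]
    rw [Finset.sum_congr (s₁ := Finset.erase _ 0) rfl (g := fun _ => h_S k n a)]
    · rw [Finset.sum_const, Finset.card_erase_of_mem (by simp), hp]
      have : 1 ≤ 2 ^ k := Nat.one_le_two_pow
      simp [h_psi_zero, hc, Nat.cast_sub this]
    · intro s hs
      simp only [Finset.mem_erase, Finset.mem_filter, Finset.mem_univ, true_and] at hs
      exact h4 s hs.2 hs.1
  rw [h5] at h1
  exact mul_left_cancel₀ (by positivity) h1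

theorem h_cross (k n : ℕ) (hc : Fintype.card F = 2 ^ n) (x u : F) :
    h_psi n (x ^ 2 ^ k * u + x * u ^ 2 ^ k) = h_psi n ((u + u ^ 2 ^ (2 * k)) * x ^ 2 ^ k) := by
  rw [add_mul, h_psi_add n hc, h_psi_add n hc, ← h_psi_frob n hc (x * u ^ 2 ^ k) k]
  congr 2 <;> ring

theorem h_exp (k : ℕ) (a x u : F) : (x + u) ^ (2 ^ k + 1) + a * (x + u) ^ 2 =
    (x ^ (2 ^ k + 1) + a * x ^ 2) + (u ^ (2 ^ k + 1) + a * u ^ 2) +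
      (x ^ 2 ^ k * u + x * u ^ 2 ^ k) := by
  have := CharTwo.add_self_eq_zero (a * x * u)
  rw [pow_succ, h_add]
  linear_combination this

theorem h_psi_fixed (k m0 : ℕ) (hc : Fintype.card F = 2 ^ (k * (2 * m0))) (u : F)
    (hu : u ^ 2 ^ (2 * k) = u) : h_psi (k * (2 * m0)) (u ^ (2 ^ k + 1)) = 1 := by
  have h1 : (u ^ (2 ^ k + 1)) ^ 2 ^ k = u ^ (2 ^ k + 1) := by
    have : (u ^ (2 ^ k + 1)) ^ 2 ^ k = u ^ 2 ^ (2 * k) * u ^ 2 ^ k := by ring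
    rw [this, hu]; ring
  have h2 : ∀ i, (u ^ (2 ^ k + 1)) ^ (2 ^ k) ^ i = u ^ (2 ^ k + 1) := by
    intro i
    induction i with
    | zero => simp
    | succ i ih => rw [pow_succ (2 ^ k), pow_mul, ih, h1]
  have : trp (2 ^ k) (2 * m0) (u ^ (2 ^ k + 1)) = 0 := by
    simp [trp, h2, CharTwo.two_eq_zero]
  simp only [h_psi, h_tower, this]
  simp [tr2]

theorem h_S_zero (k m0 : ℕ) (hk : 1 ≤ k) (hm0 : 1 ≤ m0)
    (hc : Fintype.card F = 2 ^ (k * (2 * m0))) (a : F)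
    (ha : trp (2 ^ (2 * k)) m0 a ≠ 0) : h_S k (k * (2 * m0)) a = 0 := by
  have hn : 1 ≤ k * (2 * m0) := by nlinarith
  have hc' : Fintype.card F = (2 ^ (2 * k)) ^ m0 := by rw [hc, ← pow_mul]; congr 1; ring
  obtain ⟨θ, hθ⟩ := h_psi_nontriv (F := F) _ hn hc
  set n := k * (2 * m0) with hndef
  have hn2 : n = 2 * k * m0 := by rw [hndef]; ring
  set α := trp (2 ^ (2 * k)) m0 a with hα
  set w := trp (2 ^ (2 * k)) m0 θ with hw
  have hαp : α ^ 2 ^ (2 * k) = α := h_trp_pow _ _ hc' a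
  have hwp : w ^ 2 ^ (2 * k) = w := h_trp_pow _ _ hc' θ
  have hv : (w / α) ^ 2 ^ (2 * k) = w / α := by rw [div_pow, hαp, hwp]
  obtain ⟨u, hu⟩ := (h_bij (F := F) 1).2 (w / α)
  simp only [pow_one] at hu
  have hup : u ^ 2 ^ (2 * k) = u := by
    apply (h_bij (F := F) 1).1
    simp only [pow_one]
    rw [← pow_mul, mul_comm, pow_mul, hu, hv]
  have hvi : ∀ i, (w / α) ^ (2 ^ (2 * k)) ^ i = w / α := by
    intro i
    induction i with
    | zero => simp
    | succ i ih => rw [pow_succ (2 ^ (2 * k)), pow_mul, ih, hv]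
  have htr : trp (2 ^ (2 * k)) m0 (a * u ^ 2) = w := by
    rw [hu]
    simp only [trp, mul_pow, hvi]
    rw [← Finset.sum_mul]
    change α * (w / α) = w
    field_simp
  have hpsi : h_psi n (a * u ^ 2) = -1 := by
    rw [hn2] at hθ ⊢
    rw [h_tower] at hθ
    unfold h_psi
    rw [h_tower, htr, hθ]; simp
  have hfu : h_psi n (u ^ (2 ^ k + 1)) = 1 := h_psi_fixed k m0 hc u hup
  have e : ∑ x : F, h_psi n ((x + u) ^ (2 ^ k + 1) + a * (x + u) ^ 2) = h_S k n a :=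
      Equiv.sum_comp (Equiv.addRight u) (fun x => h_psi n (x ^ (2 ^ k + 1) + a * x ^ 2))
  have e2 : ∀ x : F, h_psi n ((x + u) ^ (2 ^ k + 1) + a * (x + u) ^ 2) =
      h_psi n (x ^ (2 ^ k + 1) + a * x ^ 2) * (-1) := by
    intro x
    rw [h_exp, h_psi_add n hc, h_psi_add n hc, h_cross k n hc, h_psi_add n hc (u ^ _), hfu, hpsi,
      hup, CharTwo.add_self_eq_zero, zero_mul, h_psi_zero]
    ring
  simp only [e2] at e
  rw [← Finset.sum_mul] at e
  change h_S k n a * -1 = _ at e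
  linarith

theorem h_S_shift (k n : ℕ) (hc : Fintype.card F = 2 ^ n) (a d : F)
    (hd : a = d ^ 2 ^ (2 * k) + d) :
    h_S k n (0 : F) = h_psi n (d ^ (2 ^ k + 1)) * h_S k n a := by
  obtain ⟨c, hcd⟩ := (h_bij (F := F) 1).2 (d ^ 2 ^ k)
  simp only [pow_one] at hcd
  have e : ∑ x : F, h_psi n ((x + c) ^ (2 ^ k + 1) + 0 * (x + c) ^ 2) = h_S k n (0 : F) :=
      Equiv.sum_comp (Equiv.addRight c) (fun x => h_psi n (x ^ (2 ^ k + 1) + 0 * x ^ 2))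
  rw [← e, h_S, Finset.mul_sum]
  refine Finset.sum_congr rfl fun x _ => ?_
  rw [h_exp, zero_mul, zero_mul, add_zero, add_zero, h_psi_add n hc, h_psi_add n hc,
    h_psi_add n hc (x ^ (2 ^ k + 1)) (a * x ^ 2)]
  have h1 : h_psi n (c ^ (2 ^ k + 1)) = h_psi n (d ^ (2 ^ k + 1)) := by
    rw [← h_psi_frob n hc (c ^ (2 ^ k + 1)) 1, ← h_psi_frob n hc (d ^ (2 ^ k + 1)) k, pow_one,
      ← pow_mul, mul_comm, pow_mul, hcd, ← pow_mul, ← pow_mul, mul_comm]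
  have h2 : h_psi n (x ^ 2 ^ k * c + x * c ^ 2 ^ k) = h_psi n (a * x ^ 2) := by
    rw [← h_psi_frob n hc _ 1, h_add, hd, add_mul, h_psi_add n hc, h_psi_add n hc,
      ← h_psi_frob n hc (d * x ^ 2) k, mul_comm]
    have e1 : (x * c ^ 2 ^ k) ^ 2 ^ 1 = d ^ 2 ^ (2 * k) * x ^ 2 := by
      have : (x * c ^ 2 ^ k) ^ 2 ^ 1 = x ^ 2 * (c ^ 2) ^ 2 ^ k := by ring
      rw [this, hcd]; ring
    have e2 : (x ^ 2 ^ k * c) ^ 2 ^ 1 = (d * x ^ 2) ^ 2 ^ k := by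
      have : (x ^ 2 ^ k * c) ^ 2 ^ 1 = (x ^ 2) ^ 2 ^ k * (c ^ 2) := by ring
      rw [this, hcd]; ring
    rw [e1, e2]
  rw [h1, h2]; ring

theorem h_S_sq (k m0 : ℕ) (hk : 1 ≤ k) (hm0 : 1 ≤ m0)
    (hc : Fintype.card F = 2 ^ (k * (2 * m0)))
    (hp : (Finset.univ.filter (fun x : F => x ^ 2 ^ (2 * k) = x)).card = 2 ^ (2 * k)) :
    h_S k (k * (2 * m0)) (0 : F) ^ 2 = ((2 ^ k) ^ (m0 + 1)) ^ 2 := by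
  have hn : 1 ≤ k * (2 * m0) := by nlinarith
  have hfix := h_psi_fixed (F := F) k m0 hc
  have hval : (((2 : ℤ) ^ k) ^ (m0 + 1)) ^ 2 = 2 ^ (2 * k) * 2 ^ (k * (2 * m0)) := by
    rw [← pow_mul, ← pow_mul, ← pow_add]; congr 1; ring
  rw [hval]
  set n := k * (2 * m0) with hndef
  have h1 : ∀ x : F, ∑ u : F, h_psi n (u ^ (2 ^ k + 1) + 0 * u ^ 2) =
      ∑ u : F, h_psi n ((x + u) ^ (2 ^ k + 1) + 0 * (x + u) ^ 2) := fun x =>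
    (Equiv.sum_comp (Equiv.addLeft x) (fun x => h_psi n (x ^ (2 ^ k + 1) + 0 * x ^ 2))).symm
  have h2 : h_S k n (0 : F) ^ 2 = ∑ x : F, ∑ u : F, h_psi n (u ^ (2 ^ k + 1)) *
      h_psi n ((u + u ^ 2 ^ (2 * k)) * x ^ 2 ^ k) := by
    rw [pow_two]
    conv_lhs => rw [h_S, Finset.sum_mul]
    refine Finset.sum_congr rfl fun x _ => ?_
    rw [h1 x, Finset.mul_sum]
    refine Finset.sum_congr rfl fun u _ => ?_
    rw [h_exp]
    simp only [zero_mul, add_zero]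
    rw [h_psi_add n hc, h_psi_add n hc, h_cross k n hc]
    have := h_psi_sq n (x ^ (2 ^ k + 1))
    linear_combination (h_psi n (u ^ (2 ^ k + 1)) *
      h_psi n ((u + u ^ 2 ^ (2 * k)) * x ^ 2 ^ k)) * this
  rw [h2, Finset.sum_comm]
  have h3 : ∀ u : F, ∑ x : F, h_psi n (u ^ (2 ^ k + 1)) *
      h_psi n ((u + u ^ 2 ^ (2 * k)) * x ^ 2 ^ k) = if u ^ 2 ^ (2 * k) = u then 2 ^ n else 0 := by
    intro u
    rw [← Finset.mul_sum, Function.Bijective.sum_comp (h_bij k)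
      (fun y => h_psi n ((u + u ^ 2 ^ (2 * k)) * y)), h_orth n hn hc]
    by_cases h : u ^ 2 ^ (2 * k) = u
    · rw [hfix u h, h, if_pos (CharTwo.add_self_eq_zero u), if_pos rfl, one_mul]
    · rw [if_neg, if_neg h, mul_zero]
      rw [CharTwo.add_eq_zero]
      exact fun h' => h h'.symm
  simp only [h3]
  rw [← Finset.sum_filter, Finset.sum_const, hp]
  simp

theorem h_S_mod (k m0 : ℕ)
    (hc : Fintype.card F = 2 ^ (k * (2 * m0))) :
    ((2 : ℤ) ^ k + 1) ∣ h_S k (k * (2 * m0)) (0 : F) - 1 := by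
  set n := k * (2 * m0) with hn
  have hdvd : 2 ^ k + 1 ∣ Fintype.card Fˣ := by
    rw [Fintype.card_units, hc, hn]
    have h1 : 2 ^ k + 1 ∣ (2 ^ k) ^ 2 - 1 := by
      have := Nat.sq_sub_sq (2 ^ k) 1
      rw [one_pow] at this
      rw [this]
      exact dvd_mul_right _ _
    have h2 := Nat.sub_dvd_pow_sub_pow ((2 ^ k) ^ 2) 1 m0
    rw [one_pow, ← pow_mul, ← pow_mul, mul_assoc] at h2
    rw [← pow_mul] at h1
    exact h1.trans h2
  have hS : h_S k n (0 : F) = 1 + ∑ x : Fˣ, h_psi n (((x ^ (2 ^ k + 1) : Fˣ) : F)) := by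
    rw [h_S, ← Finset.add_sum_erase _ _ (Finset.mem_univ (0 : F))]
    congr 1
    · simp [h_psi_zero]
    · symm
      refine Finset.sum_bij (fun (x : Fˣ) _ => (x : F)) ?_ ?_ ?_ ?_
      · intro x _; simp
      · intro x _ y _ h; exact Units.ext h
      · intro y hy; exact ⟨Units.mk0 y (by simpa using hy), by simp, by simp⟩
      · intro x _; simp
  rw [hS, add_sub_cancel_left]
  let φ : Fˣ →* Fˣ := powMonoidHom (2 ^ k + 1)
  have : ∑ x : Fˣ, h_psi n (((x ^ (2 ^ k + 1) : Fˣ) : F)) =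
      ∑ y ∈ Finset.univ.image φ, (Finset.univ.filter (fun x => φ x = y)).card • h_psi n (y : F) :=
    Finset.sum_comp (fun y : Fˣ => h_psi n (y : F)) φ
  rw [this]
  refine Finset.dvd_sum fun y hy => ?_
  have hker : (Finset.univ.filter (fun x => φ x = y)).card = 2 ^ k + 1 := by
    have h1 : (Finset.univ.filter (fun x => φ x = y)).card
        = (Finset.univ.filter (fun x => φ x = 1)).card :=
      MonoidHom.card_fiber_eq_of_mem_range φ (by simpa using hy) ⟨1, map_one _⟩
    rw [h1]
    have hle : (Finset.univ.filter (fun x => φ x = 1)).card ≤ 2 ^ k + 1 :=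
      IsCyclic.card_pow_eq_one_le (α := Fˣ) (by positivity)
    refine le_antisymm hle ?_
    obtain ⟨N, hN⟩ := hdvd
    have hN0 : 0 < N := by
      rcases Nat.eq_zero_or_pos N with h | h
      · rw [h] at hN; simp at hN
      · exact h
    have hrange : (Finset.univ.image φ).card ≤ N := by
      refine le_trans (Finset.card_le_card ?_) (IsCyclic.card_pow_eq_one_le (α := Fˣ) hN0)
      intro z hz
      obtain ⟨w, -, rfl⟩ := Finset.mem_image.1 hz
      simp only [Finset.mem_filter, Finset.mem_univ, true_and]
      change (w ^ (2 ^ k + 1)) ^ N = 1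
      rw [← pow_mul, ← hN, pow_card_eq_one]
    have hsum : Fintype.card Fˣ
        = (Finset.univ.image φ).card * (Finset.univ.filter (fun x => φ x = 1)).card := by
      rw [← Finset.card_univ, Finset.card_eq_sum_card_image φ Finset.univ,
        Finset.sum_congr rfl (g := fun _ => (Finset.univ.filter (fun x => φ x = 1)).card)]
      · rw [Finset.sum_const, smul_eq_mul]
      · intro z hz
        exact MonoidHom.card_fiber_eq_of_mem_range φ (by simpa using hz) ⟨1, map_one _⟩
    rw [hN] at hsum
    have := Nat.mul_le_mul_right (Finset.univ.filter (fun x => φ x = 1)).card hrange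
    rw [← hsum, mul_comm] at this
    exact Nat.le_of_mul_le_mul_left this hN0
  rw [hker]
  refine ⟨h_psi n (y : F), ?_⟩
  simp

theorem h_S_val (k m0 : ℕ) (hk : 1 ≤ k) (hm0 : 1 ≤ m0)
    (hc : Fintype.card F = 2 ^ (k * (2 * m0)))
    (hp : (Finset.univ.filter (fun x : F => x ^ 2 ^ (2 * k) = x)).card = 2 ^ (2 * k)) :
    h_S k (k * (2 * m0)) (0 : F) = (-1) ^ (m0 + 1) * (2 ^ k) ^ (m0 + 1) := by
  have h1 := h_S_sq k m0 hk hm0 hc hp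
  have h2 := h_S_mod k m0 hc
  have h3 : ((2 : ℤ) ^ k + 1) ∣ ((2 : ℤ) ^ k) ^ (m0 + 1) - (-1) ^ (m0 + 1) := by
    have := sub_dvd_pow_sub_pow ((2 : ℤ) ^ k) (-1) (m0 + 1)
    simpa using this
  have h4 : ((2 : ℤ) ^ k + 1) > 2 := by
    have : (1 : ℤ) < 2 ^ k := one_lt_pow₀ (by norm_num) (by omega)
    linarith
  rcases neg_one_pow_eq_or ℤ (m0 + 1) with h | h <;> rw [h] at h3 ⊢ <;>
    rcases sq_eq_sq_iff_eq_or_eq_neg.1 h1 with h' | h' <;> rw [h'] at h2 ⊢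
  · ring
  · have h5 := dvd_neg.2 (dvd_add h2 h3)
    ring_nf at h5
    have := Int.le_of_dvd (by norm_num) h5
    linarith
  · have h5 := dvd_neg.2 (dvd_sub h2 h3)
    ring_nf at h5
    have := Int.le_of_dvd (by norm_num) h5
    linarith
  · ring
end H14

/-- Point counts of the twists `y^p + y = x^{p+1} + a x²` of the
Hermitian curve. -/
theorem statement14 {K : Type*} [Field K] [Fintype K] [CharP K 2]
    (k m0 : ℕ) (hk : 1 ≤ k) (hm0 : 1 ≤ m0)
    (hcard : Fintype.card K = 2 ^ (k * (2 * m0)))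
    (a : K) :
    ((∑ i ∈ Finset.range m0, a ^ ((2 ^ k) ^ 2) ^ i) ≠ 0 →
      (Nat.card {z : K × K //
          z.2 ^ 2 ^ k + z.2 = z.1 ^ (2 ^ k + 1) + a * z.1 ^ 2} : ℤ)
        = 2 ^ (k * (2 * m0))) ∧
    ((∑ i ∈ Finset.range m0, a ^ ((2 ^ k) ^ 2) ^ i) = 0 →
      (∑ jj ∈ (Finset.range (2 * m0)).filter (fun jj => jj % 2 = 0),
          ∑ ii ∈ (Finset.range jj).filter (fun ii => ii % 2 = 1),
            a ^ (2 ^ k) ^ ii * a ^ (2 ^ k) ^ jj) ^ 2 ^ k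
        = (∑ jj ∈ (Finset.range (2 * m0)).filter (fun jj => jj % 2 = 0),
            ∑ ii ∈ (Finset.range jj).filter (fun ii => ii % 2 = 1),
              a ^ (2 ^ k) ^ ii * a ^ (2 ^ k) ^ jj) ∧
      ((Nat.card {z : K × K //
            z.2 ^ 2 ^ k + z.2 = z.1 ^ (2 ^ k + 1) + a * z.1 ^ 2} : ℤ)
          = 2 ^ (k * (2 * m0)) + (2 ^ k - 1) * (2 ^ k) ^ (1 + m0) ∨
        (Nat.card {z : K × K //
            z.2 ^ 2 ^ k + z.2 = z.1 ^ (2 ^ k + 1) + a * z.1 ^ 2} : ℤ)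
          = 2 ^ (k * (2 * m0)) - (2 ^ k - 1) * (2 ^ k) ^ (1 + m0)) ∧
      ((Nat.card {z : K × K //
            z.2 ^ 2 ^ k + z.2 = z.1 ^ (2 ^ k + 1) + a * z.1 ^ 2} : ℤ)
          = 2 ^ (k * (2 * m0)) + (2 ^ k - 1) * (2 ^ k) ^ (1 + m0) ↔
        tr2 k (∑ jj ∈ (Finset.range (2 * m0)).filter (fun jj => jj % 2 = 0),
            ∑ ii ∈ (Finset.range jj).filter (fun ii => ii % 2 = 1),
              a ^ (2 ^ k) ^ ii * a ^ (2 ^ k) ^ jj) = ((m0 + 1 : ℕ) : K))) := by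
  have hn : 1 ≤ k * (2 * m0) := by nlinarith
  have hc1 : Fintype.card K = (2 ^ k) ^ (2 * m0) := by rw [hcard, ← pow_mul]
  have hc2 : Fintype.card K = (2 ^ (2 * k)) ^ m0 := by rw [hcard, ← pow_mul]; congr 1; ring
  obtain ⟨hp1, -⟩ := h_main (F := K) k (2 * m0) hk (by omega) hc1
  obtain ⟨hp2, hsurj⟩ := h_main (F := K) (2 * k) m0 (by omega) hm0 hc2
  have hcount := h_count k _ hn hcard hp1 a
  have hα : (∑ i ∈ Finset.range m0, a ^ ((2 ^ k) ^ 2) ^ i) = trp (2 ^ (2 * k)) m0 a := by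
    simp only [trp]
    rw [mul_comm 2 k, pow_mul]
  rw [hα, hcount]
  refine ⟨fun h => ?_, fun h => ?_⟩
  · rw [h_S_zero k m0 hk hm0 hcard a h, mul_zero, add_zero]
  · obtain ⟨d, hd⟩ := hsurj a h
    rw [h_beta k m0 hcard a d hd]
    refine ⟨h_trp_pow _ _ hc1 _, ?_⟩
    have hs := h_S_shift k _ hcard a d hd
    have hS : h_S k (k * (2 * m0)) a =
        h_psi (k * (2 * m0)) (d ^ (2 ^ k + 1)) * ((-1) ^ (m0 + 1) * (2 ^ k) ^ (m0 + 1)) := by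
      rw [← h_S_val k m0 hk hm0 hcard hp2, hs, ← mul_assoc (h_psi _ _), h_psi_sq, one_mul]
    have hA : (0 : ℤ) < (2 ^ k - 1) * (2 ^ k) ^ (1 + m0) := by
      have : (1 : ℤ) < 2 ^ k := one_lt_pow₀ (by norm_num) (by omega)
      have h' : (0 : ℤ) < 2 ^ k - 1 := by linarith
      positivity
    have h01 := h_tr2_01 _ hcard (d ^ (2 ^ k + 1))
    rw [hS]
    unfold h_psi
    rw [h_tower] at h01 ⊢
    rw [add_comm m0 1] at *
    set A : ℤ := (2 ^ k) ^ (1 + m0)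
    rcases Nat.even_or_odd (1 + m0) with he | ho
    · have hz : ((1 + m0 : ℕ) : K) = 0 := by
        obtain ⟨r, hr⟩ := he
        rw [hr, Nat.cast_add, CharTwo.add_self_eq_zero]
      rw [hz, he.neg_one_pow]
      rcases h01 with h0 | h0 <;> rw [h0]
      · simp
      · simp only [one_ne_zero, if_false, iff_false]
        exact ⟨Or.inr (by ring), fun hh => by linarith⟩
    · have hz : ((1 + m0 : ℕ) : K) = 1 := by
        obtain ⟨r, hr⟩ := ho
        rw [hr, Nat.cast_add, two_mul, Nat.cast_add, CharTwo.add_self_eq_zero]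
        simp
      rw [hz, ho.neg_one_pow]
      rcases h01 with h0 | h0 <;> rw [h0]
      · simp only [if_true, zero_ne_one, iff_false]
        exact ⟨Or.inr (by ring), fun hh => by linarith⟩
      · simp


end
end
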